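/- Sharper global finite-parameter Hessian estimate. Let n ≥ 1 be an integer and d, D reals with n ≤ d ≤ D < ∞. Let V, W : ℝⁿ → ℝ be C² with V > −d and W > −D pointwise, Z_{V,d} and Z_{W,D} finite, D²V ≤ C_V⁽²⁾·Id and D²W ≥ c_W⁽²⁾·Id with 0 < c_W⁽²⁾, C_V⁽²⁾ < ∞. Assume the global constants satisfy 0 < c⁽⁰⁾_{V,d} ≤ C⁽⁰⁾_{V,d} < ∞, 0 < c⁽⁰⁾_{W,D} ≤ C⁽⁰⁾_{W,D} < ∞, and C⁽¹⁾_{V,d}, C⁽¹⁾_{W,D} < ∞. Let φ : ℝⁿ → ℝ be convex and C² with (∇φ)_# μ_{V,d} = μ_{W,D}. Define I_p = ∫_{ℝⁿ}(1 + |z|²/p)^{−p} dz, K = 3·[ (C⁽⁰⁾_{V,d}/c⁽⁰⁾_{V,d})^d · (C⁽⁰⁾_{W,D}/c⁽⁰⁾_{W,D})^D · (5/4)^d · 10^{2d} · 3^{−n} · (D/d)^D · I_d/I_D ]^{1/(2D−n)}, M = (d/D)·K², Γ = max{0,(2d−D)/(D−d)} if d < D and Γ = +∞ if d = D, A = C_V⁽²⁾·C⁽⁰⁾_{W,D}·(1+M)/(c_W⁽²⁾·c⁽⁰⁾_{V,d}),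 and B = (4·C⁽¹⁾_{V,d}/((c_W⁽²⁾)²·(c⁽⁰⁾_{V,d})²))·min{ C⁽¹⁾_{W,D}·(D/d)·(1+M), c_W⁽²⁾·C⁽⁰⁾_{W,D}·(1+M)·Γ } (when d = D the min equals its first argument). Then for every x ∈ ℝⁿ and every unit vector e, ⟨D²φ(x)e, e⟩ ≤ √(A + B) + √B. -/

import Mathlib

open MeasureTheory Metric Set
open scoped ENNReal RealInnerProductSpace

noncomputable section

/-- Euclidean space `ℝⁿ`. -/
abbrev Euc (n : ℕ) := EuclideanSpace ℝ (Fin n)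

/-- The second directional derivative `⟨D²f(x)v, v⟩`. -/
def hess {n : ℕ} (f : Euc n → ℝ) (x v : Euc n) : ℝ :=
  iteratedFDeriv ℝ 2 f x ![v, v]

/-- The normalization constant `Z_{U,p} = ∫ (1 + U(x)/p)^(−p) dx`. -/
def Znorm {n : ℕ} (U : Euc n → ℝ) (p : ℝ) : ℝ :=
  ∫ x, (1 + U x / p) ^ (-p)

/-- The measure `μ_{U,p}` with density `Z_{U,p}⁻¹ (1 + U(x)/p)^(−p)` w.r.t. Lebesgue. -/
def muUP {n : ℕ} (U : Euc n → ℝ) (p : ℝ) : Measure (Euc n) :=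
  volume.withDensity fun x => ENNReal.ofReal ((Znorm U p)⁻¹ * (1 + U x / p) ^ (-p))

/-- The ratio `(p + U(x))/(p + |x|²)`. -/
def ratio0 {n : ℕ} (U : Euc n → ℝ) (p : ℝ) (x : Euc n) : ℝ :=
  (p + U x) / (p + ‖x‖ ^ 2)

/-- The ratio `|∇U(x)|²/(√p + |x|)²`. -/
def ratio1 {n : ℕ} (U : Euc n → ℝ) (p : ℝ) (x : Euc n) : ℝ :=
  ‖gradient U x‖ ^ 2 / (Real.sqrt p + ‖x‖) ^ 2

/-- `c⁽⁰⁾_{U,p}(S) = inf_{x ∈ S} (p + U(x))/(p + |x|²)`. -/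
def cLow {n : ℕ} (U : Euc n → ℝ) (p : ℝ) (S : Set (Euc n)) : ℝ := sInf (ratio0 U p '' S)

/-- `C⁽⁰⁾_{U,p}(S) = sup_{x ∈ S} (p + U(x))/(p + |x|²)`. -/
def cUp {n : ℕ} (U : Euc n → ℝ) (p : ℝ) (S : Set (Euc n)) : ℝ := sSup (ratio0 U p '' S)

/-- `C⁽¹⁾_{U,p}(S) = sup_{x ∈ S} |∇U(x)|²/(√p + |x|)²`. -/
def cGrad {n : ℕ} (U : Euc n → ℝ) (p : ℝ) (S : Set (Euc n)) : ℝ := sSup (ratio1 U p '' S)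

/-- The Lebesgue volume of the unit ball in `ℝⁿ`. -/
def unitBallVol (n : ℕ) : ℝ := (volume (ball (0 : Euc n) 1)).toReal

/-- `I_p = ∫_{ℝⁿ} (1 + |z|²/p)^(−p) dz`. -/
def Ipol (n : ℕ) (p : ℝ) : ℝ := ∫ z : Euc n, (1 + ‖z‖ ^ 2 / p) ^ (-p)

section Helpers
open Filter Topology

section Calculus
variable {n : ℕ}

lemma gradient_contDiff {f : Euc n → ℝ} (hf : ContDiff ℝ 2 f) : ContDiff ℝ 1 (gradient f) := by
  have h1 : ContDiff ℝ 1 (fderiv ℝ f) := hf.fderiv_right (by norm_num)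
  exact ((InnerProductSpace.toDual ℝ (Euc n)).symm.contDiff).comp h1

lemma inner_gradient {f : Euc n → ℝ} (x v : Euc n) :
    ⟪gradient f x, v⟫ = fderiv ℝ f x v := by
  simp [gradient]

lemma hess_eq_inner {f : Euc n → ℝ} (hf : ContDiff ℝ 2 f) (x v : Euc n) :
    hess f x v = ⟪fderiv ℝ (gradient f) x v, v⟫ := by
  have h1 : Differentiable ℝ (fderiv ℝ f) :=
    (hf.fderiv_right (m := 1) (by norm_num)).differentiable (by norm_num)
  have hg : Differentiable ℝ (gradient f) := (gradient_contDiff hf).differentiable (by norm_num)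
  have h2 : HasFDerivAt (fun y => ⟪gradient f y, v⟫)
      ((fderivInnerCLM ℝ (gradient f x, v)).comp ((fderiv ℝ (gradient f) x).prod 0)) x :=
    (hg x).hasFDerivAt.inner ℝ (hasFDerivAt_const v x)
  have h3 : HasFDerivAt (fun y => ⟪gradient f y, v⟫)
      ((ContinuousLinearMap.apply ℝ ℝ v).comp (fderiv ℝ (fderiv ℝ f) x)) x := by
    have : (fun y => ⟪gradient f y, v⟫) = fun y => fderiv ℝ f y v := by
      ext y; exact inner_gradient y v
    rw [this]
    exact (ContinuousLinearMap.apply ℝ ℝ v).hasFDerivAt.comp x (h1 x).hasFDerivAt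
  have h4 := congrArg (fun L => L v) (h2.unique h3)
  simp [fderivInnerCLM_apply] at h4
  rw [hess, iteratedFDeriv_two_apply, h4]
  simp

lemma hasDerivAt_line {f : Euc n → ℝ} (hf : ContDiff ℝ 2 f) (x v : Euc n) (t : ℝ) :
    HasDerivAt (fun s : ℝ => f (x + s • v)) ⟪gradient f (x + t • v), v⟫ t := by
  have hl : HasDerivAt (fun s : ℝ => x + s • v) v t := by
    simpa using ((hasDerivAt_id t).smul_const v).const_add x
  rw [inner_gradient]
  exact ((hf.differentiable (by norm_num)) (x + t • v)).hasFDerivAt.comp_hasDerivAt t hl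

lemma hasDerivAt_line2 {f : Euc n → ℝ} (hf : ContDiff ℝ 2 f) (x v : Euc n) (t : ℝ) :
    HasDerivAt (fun s : ℝ => ⟪gradient f (x + s • v), v⟫) (hess f (x + t • v) v) t := by
  have hl : HasDerivAt (fun s : ℝ => x + s • v) v t := by
    simpa using ((hasDerivAt_id t).smul_const v).const_add x
  have hg : Differentiable ℝ (gradient f) := (gradient_contDiff hf).differentiable (by norm_num)
  have h := (hg (x + t • v)).hasFDerivAt.comp_hasDerivAt t hl
  rw [hess_eq_inner hf]
  have := h.inner ℝ (hasDerivAt_const t v)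
  simpa using this

lemma taylor_upper {f : Euc n → ℝ} (hf : ContDiff ℝ 2 f) (C : ℝ) (x v : Euc n)
    (h : ∀ z, hess f z v ≤ C) : f (x + v) ≤ f x + ⟪gradient f x, v⟫ + C / 2 := by
  set c := ⟪gradient f x, v⟫
  have hd1 : ∀ t : ℝ, HasDerivAt (fun s : ℝ => f (x + s • v) - s * c - C * s ^ 2 / 2)
      (⟪gradient f (x + t • v), v⟫ - c - C * t) t := by
    intro t
    have h1 := ((hasDerivAt_line hf x v t).sub ((hasDerivAt_id t).mul_const c)).sub
      ((((hasDerivAt_id t).pow 2).const_mul C).div_const 2)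
    convert! h1 using 1
    simp; ring
  have hd2 : ∀ t : ℝ, HasDerivAt (fun s : ℝ => ⟪gradient f (x + s • v), v⟫ - c - C * s)
      (hess f (x + t • v) v - C) t := by
    intro t
    have h1 := ((hasDerivAt_line2 hf x v t).sub_const c).sub ((hasDerivAt_id t).const_mul C)
    convert! h1 using 1
    simp
  have hanti : Antitone (fun s : ℝ => ⟪gradient f (x + s • v), v⟫ - c - C * s) := by
    apply antitone_of_deriv_nonpos (fun t => (hd2 t).differentiableAt)
    intro t
    rw [(hd2 t).deriv]
    linarith [h (x + t • v)]
  have hanti2 : AntitoneOn (fun s : ℝ => f (x + s • v) - s * c - C * s ^ 2 / 2) (Ici 0) := by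
    apply antitoneOn_of_deriv_nonpos (convex_Ici 0)
    · exact fun t _ => (hd1 t).continuousAt.continuousWithinAt
    · exact fun t _ => (hd1 t).differentiableAt.differentiableWithinAt
    · intro t ht
      rw [(hd1 t).deriv]
      rw [interior_Ici] at ht
      have := hanti (le_of_lt ht)
      simp only [zero_smul, add_zero] at this
      have hc : ⟪gradient f x, v⟫ = c := rfl
      linarith
  have := hanti2 (mem_Ici.2 le_rfl) (mem_Ici.2 zero_le_one) zero_le_one
  simp at this
  linarith

lemma taylor_lower {f : Euc n → ℝ} (hf : ContDiff ℝ 2 f) (C : ℝ) (x v : Euc n)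
    (h : ∀ z, C ≤ hess f z v) : f x + ⟪gradient f x, v⟫ + C / 2 ≤ f (x + v) := by
  have hneg : ∀ z, gradient (fun y => - f y) z = - gradient f z := by
    intro z
    simp only [gradient, fderiv_fun_neg, map_neg]
  have h2 : ∀ z, hess (fun y => - f y) z v ≤ -C := by
    intro z
    rw [hess_eq_inner hf.neg]
    have : gradient (fun y => - f y) = fun y => - gradient f y := funext hneg
    rw [this, fderiv_fun_neg]
    have := h z
    rw [hess_eq_inner hf] at this
    simp; linarith
  have := taylor_upper hf.neg (-C) x v h2
  simp only [hneg, inner_neg_left] at this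
  linarith

lemma tendsto_secdiff {f : Euc n → ℝ} (hf : ContDiff ℝ 2 f) (x v : Euc n) :
    Tendsto (fun t : ℝ => (f (x + t • v) + f (x - t • v) - 2 * f x) / t ^ 2) (𝓝[>] 0)
      (𝓝 (hess f x v)) := by
  have hm : ∀ t : ℝ, HasDerivAt (fun s : ℝ => f (x - s • v)) (-⟪gradient f (x - t • v), v⟫) t := by
    intro t
    have h1 := hasDerivAt_line hf x (-v) t
    simp only [smul_neg, ← sub_eq_add_neg, inner_neg_right] at h1
    exact h1
  have hm2 : HasDerivAt (fun s : ℝ => ⟪gradient f (x - s • v), v⟫) (-hess f x v) 0 := by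
    have h1 := hasDerivAt_line2 hf x v (-0)
    have h2 := HasDerivAt.scomp (0:ℝ) (h := fun s : ℝ => -s) h1 (hasDerivAt_neg (0:ℝ))
    have e : (fun s : ℝ => ⟪gradient f (x - s • v), v⟫) =
        (fun s : ℝ => ⟪gradient f (x + s • v), v⟫) ∘ (fun s : ℝ => -s) := by
      ext s; simp only [Function.comp, neg_smul, sub_eq_add_neg]
    rw [e]
    simpa using h2
  have hp2 := hasDerivAt_line2 hf x v 0
  apply HasDerivAt.lhopital_zero_nhdsGT
    (f' := fun t => ⟪gradient f (x + t • v), v⟫ - ⟪gradient f (x - t • v), v⟫)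
    (g' := fun t => 2 * t)
  · filter_upwards with t
    have := ((hasDerivAt_line hf x v t).add (hm t)).sub_const (2 * f x)
    simpa [sub_eq_add_neg] using this
  · filter_upwards with t
    simpa using hasDerivAt_pow 2 t
  · filter_upwards [self_mem_nhdsWithin] with t ht
    have : 0 < t := ht
    positivity
  · have hc : ContinuousAt (fun t : ℝ => f (x + t • v) + f (x - t • v) - 2 * f x) 0 :=
      (((hasDerivAt_line hf x v 0).add (hm 0)).sub_const (2 * f x)).continuousAt
    have := hc.tendsto.mono_left (nhdsWithin_le_nhds (s := Ioi 0))
    convert this using 2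
    simp; ring
  · have hc : ContinuousAt (fun t : ℝ => t ^ 2) 0 := by fun_prop
    have := hc.tendsto.mono_left (nhdsWithin_le_nhds (s := Ioi 0))
    simpa using this
  · have hd := (hp2.sub hm2)
    rw [hasDerivAt_iff_tendsto_slope] at hd
    have hd' := hd.mono_left (nhdsWithin_mono (0:ℝ) (s := Ioi 0) (fun t (ht : 0 < t) => ht.ne'))
    have hd2 := hd'.div_const 2
    have e : (hess f (x + (0:ℝ) • v) v - -hess f x v) / 2 = hess f x v := by simp
    rw [e] at hd2
    refine hd2.congr' ?_
    filter_upwards [self_mem_nhdsWithin] with t ht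
    have : 0 < t := ht
    simp [slope_def_field]
    field_simp

lemma hess_nonneg {φ : Euc n → ℝ} (hφ : ContDiff ℝ 2 φ) (hc : ConvexOn ℝ univ φ) (x v : Euc n) :
    0 ≤ hess φ x v := by
  apply ge_of_tendsto (tendsto_secdiff hφ x v)
  filter_upwards with t
  apply div_nonneg _ (sq_nonneg t)
  have := hc.2 (mem_univ (x + t • v)) (mem_univ (x - t • v)) (show (0:ℝ) ≤ 1/2 by norm_num)
    (show (0:ℝ) ≤ 1/2 by norm_num) (by norm_num)
  have e : (1/2 : ℝ) • (x + t • v) + (1/2 : ℝ) • (x - t • v) = x := by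
    rw [← smul_add, show x + t • v + (x - t • v) = (2:ℝ) • x by rw [two_smul]; abel, smul_smul]
    norm_num
  rw [e] at this
  simp at this
  linarith

lemma grad_ineq {φ : Euc n → ℝ} (hφ : ContDiff ℝ 2 φ) (hc : ConvexOn ℝ univ φ) (x y : Euc n) :
    φ x + ⟪gradient φ x, y - x⟫ ≤ φ y := by
  have := taylor_lower hφ 0 x (y - x) (fun z => hess_nonneg hφ hc z _)
  simpa using this

lemma grad_mono {φ : Euc n → ℝ} (hφ : ContDiff ℝ 2 φ) (hc : ConvexOn ℝ univ φ) (x y : Euc n) :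
    ⟪gradient φ x, y - x⟫ ≤ ⟪gradient φ y, y - x⟫ := by
  have h1 := grad_ineq hφ hc x y
  have h2 := grad_ineq hφ hc y x
  have : ⟪gradient φ y, x - y⟫ = -⟪gradient φ y, y - x⟫ := by
    rw [← inner_neg_right]; simp
  linarith

/-- symmetry of the derivative of the gradient -/
lemma fderiv_gradient_symm {f : Euc n → ℝ} (hf : ContDiff ℝ 2 f) (x v w : Euc n) :
    ⟪fderiv ℝ (gradient f) x v, w⟫ = ⟪v, fderiv ℝ (gradient f) x w⟫ := by
  have key : ∀ v w, ⟪fderiv ℝ (gradient f) x v, w⟫ = fderiv ℝ (fderiv ℝ f) x v w := by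
    intro v w
    have h1 : Differentiable ℝ (fderiv ℝ f) :=
      (hf.fderiv_right (m := 1) (by norm_num)).differentiable (by norm_num)
    have hg : Differentiable ℝ (gradient f) := (gradient_contDiff hf).differentiable (by norm_num)
    have h2 := (hg x).hasFDerivAt.inner ℝ (hasFDerivAt_const w x)
    have h3 : HasFDerivAt (fun y => ⟪gradient f y, w⟫)
        ((ContinuousLinearMap.apply ℝ ℝ w).comp (fderiv ℝ (fderiv ℝ f) x)) x := by
      have : (fun y => ⟪gradient f y, w⟫) = fun y => fderiv ℝ f y w := by
        ext y; exact inner_gradient y w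
      rw [this]
      exact (ContinuousLinearMap.apply ℝ ℝ w).hasFDerivAt.comp x (h1 x).hasFDerivAt
    have h4 := congrArg (fun L => L v) (h2.unique h3)
    simpa [fderivInnerCLM_apply] using h4
  rw [key, real_inner_comm, key]
  have hs : IsSymmSndFDerivAt ℝ f x := hf.contDiffAt.isSymmSndFDerivAt (by simp)
  exact hs v w

end Calculus

section Dets
variable {n : ℕ}

lemma det_rpow_le_trace (hn : 1 ≤ n) {A : Matrix (Fin n) (Fin n) ℝ} (hA : A.PosSemidef) :
    A.det ^ (1 / (n : ℝ)) ≤ A.trace / n := by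
  have hn0 : (0 : ℝ) < n := by exact_mod_cast hn
  have h1 := Real.geom_mean_le_arith_mean_weighted Finset.univ (fun _ => 1 / (n : ℝ))
    (hA.1.eigenvalues) (fun i _ => by positivity) (by simp; field_simp)
    (fun i _ => hA.eigenvalues_nonneg i)
  have h2 := hA.1.det_eq_prod_eigenvalues
  have h3 := hA.1.trace_eq_sum_eigenvalues
  simp at h2 h3
  rw [h2, h3, ← Real.finsetProd_rpow _ _ (fun i _ => hA.eigenvalues_nonneg i)]
  refine h1.trans (le_of_eq ?_)
  rw [← Finset.mul_sum]
  ring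

open scoped MatrixOrder in
lemma det_mink (hn : 1 ≤ n) {A B C : Matrix (Fin n) (Fin n) ℝ} (hA : A.PosSemidef)
    (hB : B.PosSemidef) (hC : C.PosSemidef) (hCd : 0 < C.det) (T : ℝ)
    (h : (T • C - A - B).PosSemidef) :
    A.det ^ (1 / (n : ℝ)) + B.det ^ (1 / (n : ℝ)) ≤ T * C.det ^ (1 / (n : ℝ)) := by
  have hn0 : (0 : ℝ) < n := by exact_mod_cast hn
  obtain ⟨X, hX⟩ := CStarAlgebra.nonneg_iff_eq_star_mul_self.mp hC.nonneg
  have hdet : C.det = X.det ^ 2 := by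
    rw [hX, Matrix.det_mul, Matrix.star_eq_conjTranspose, Matrix.det_conjTranspose]; simp; ring
  have hXd : X.det ≠ 0 := by
    intro h0; rw [hdet, h0] at hCd; norm_num at hCd
  have hXu : IsUnit X.det := isUnit_iff_ne_zero.2 hXd
  set Y := X⁻¹
  have hYd : Y.det ^ 2 * C.det = 1 := by
    rw [hdet, ← mul_pow, ← Matrix.det_mul, Matrix.nonsing_inv_mul _ hXu]; simp
  have hCY : Y.conjTranspose * C * Y = 1 := by
    rw [hX, Matrix.star_eq_conjTranspose]
    have e1 : X * Y = 1 := Matrix.mul_nonsing_inv _ hXu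
    have e2 : Y.conjTranspose * X.conjTranspose = 1 := by
      rw [← Matrix.conjTranspose_mul, e1]; simp
    calc Y.conjTranspose * (X.conjTranspose * X) * Y
        = (Y.conjTranspose * X.conjTranspose) * (X * Y) := by simp only [Matrix.mul_assoc]
      _ = 1 := by rw [e1, e2]; simp
  have key : ∀ {M : Matrix (Fin n) (Fin n) ℝ}, M.PosSemidef →
      M.det ^ (1 / (n : ℝ)) ≤ C.det ^ (1 / (n : ℝ)) * ((Y.conjTranspose * M * Y).trace / n) := by
    intro M hM
    have hM' := hM.conjTranspose_mul_mul_same Y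
    have h1 := det_rpow_le_trace hn hM'
    have h2 : (Y.conjTranspose * M * Y).det = Y.det ^ 2 * M.det := by
      rw [Matrix.det_mul, Matrix.det_mul, Matrix.det_conjTranspose]; simp; ring
    have h3 : M.det = C.det * (Y.conjTranspose * M * Y).det := by
      rw [h2, ← mul_assoc, mul_comm C.det, hYd, one_mul]
    calc M.det ^ (1 / (n : ℝ)) = C.det ^ (1 / (n : ℝ)) * (Y.conjTranspose * M * Y).det ^ (1 / (n : ℝ)) := by
          rw [h3, Real.mul_rpow hCd.le hM'.det_nonneg]
      _ ≤ _ := by gcongr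
  have h4 := (h.conjTranspose_mul_mul_same Y).trace_nonneg
  have h5 : (Y.conjTranspose * (T • C - A - B) * Y).trace
      = T * n - (Y.conjTranspose * A * Y).trace - (Y.conjTranspose * B * Y).trace := by
    rw [Matrix.mul_sub, Matrix.mul_sub, Matrix.sub_mul, Matrix.sub_mul, Matrix.mul_smul,
      Matrix.smul_mul, hCY, Matrix.trace_sub, Matrix.trace_sub]
    simp
  rw [h5] at h4
  have hcp : 0 ≤ C.det ^ (1 / (n : ℝ)) := by positivity
  calc _ ≤ C.det ^ (1 / (n : ℝ)) * ((Y.conjTranspose * A * Y).trace / n)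
        + C.det ^ (1 / (n : ℝ)) * ((Y.conjTranspose * B * Y).trace / n) :=
        add_le_add (key hA) (key hB)
    _ = C.det ^ (1 / (n : ℝ)) * (((Y.conjTranspose * A * Y).trace +
          (Y.conjTranspose * B * Y).trace) / n) := by ring
    _ ≤ C.det ^ (1 / (n : ℝ)) * T := by
        gcongr
        rw [div_le_iff₀ hn0]; linarith
    _ = _ := by ring

/-- matrix of a linear operator in the standard basis -/
def opMat (L : Euc n →L[ℝ] Euc n) : Matrix (Fin n) (Fin n) ℝ :=
  LinearMap.toMatrix (EuclideanSpace.basisFun (Fin n) ℝ).toBasis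
    (EuclideanSpace.basisFun (Fin n) ℝ).toBasis (L : Euc n →ₗ[ℝ] Euc n)

lemma opMat_det (L : Euc n →L[ℝ] Euc n) : (opMat L).det = L.det := by
  unfold opMat
  rw [LinearMap.det_toMatrix]

lemma opMat_quad (L : Euc n →L[ℝ] Euc n) (v : Fin n → ℝ) :
    v ⬝ᵥ ((opMat L).mulVec v) = ⟪L (WithLp.toLp 2 v), WithLp.toLp 2 v⟫ := by
  have h := LinearMap.toMatrix_mulVec_repr (EuclideanSpace.basisFun (Fin n) ℝ).toBasis
    (EuclideanSpace.basisFun (Fin n) ℝ).toBasis (L : Euc n →ₗ[ℝ] Euc n) (WithLp.toLp 2 v)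
  have e : ((EuclideanSpace.basisFun (Fin n) ℝ).toBasis.repr (WithLp.toLp 2 v) : Fin n → ℝ) = v := by
    ext i; simp
  rw [e] at h
  unfold opMat
  rw [h]
  simp [PiLp.inner_apply, dotProduct]

lemma opMat_herm (L : Euc n →L[ℝ] Euc n) (hs : ∀ v w, ⟪L v, w⟫ = ⟪v, L w⟫) :
    (opMat L).IsHermitian := by
  ext i j
  have := hs (EuclideanSpace.single i 1) (EuclideanSpace.single j 1)
  simp [opMat, LinearMap.toMatrix_apply]
  simpa [EuclideanSpace.inner_single_left, EuclideanSpace.inner_single_right] using this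

lemma opMat_psd (L : Euc n →L[ℝ] Euc n) (hs : ∀ v w, ⟪L v, w⟫ = ⟪v, L w⟫)
    (hp : ∀ v, 0 ≤ ⟪L v, v⟫) : (opMat L).PosSemidef := by
  apply Matrix.PosSemidef.of_dotProduct_mulVec_nonneg (opMat_herm L hs)
  intro v
  simp only [star_trivial]
  rw [opMat_quad]; exact hp _

lemma op_mink (hn : 1 ≤ n) {A B C : Euc n →L[ℝ] Euc n}
    (hAs : ∀ v w, ⟪A v, w⟫ = ⟪v, A w⟫) (hA : ∀ v, 0 ≤ ⟪A v, v⟫)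
    (hBs : ∀ v w, ⟪B v, w⟫ = ⟪v, B w⟫) (hB : ∀ v, 0 ≤ ⟪B v, v⟫)
    (hCs : ∀ v w, ⟪C v, w⟫ = ⟪v, C w⟫) (hC : ∀ v, 0 ≤ ⟪C v, v⟫)
    (hCd : 0 < C.det) (T : ℝ)
    (h : ∀ v, ⟪A v, v⟫ + ⟪B v, v⟫ ≤ T * ⟪C v, v⟫) :
    A.det ^ (1 / (n : ℝ)) + B.det ^ (1 / (n : ℝ)) ≤ T * C.det ^ (1 / (n : ℝ)) := by
  rw [← opMat_det A, ← opMat_det B, ← opMat_det C]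
  apply det_mink hn (opMat_psd A hAs hA) (opMat_psd B hBs hB) (opMat_psd C hCs hC)
  · rwa [opMat_det]
  · have e : T • opMat C - opMat A - opMat B = opMat (T • C - A - B) := by
      simp [opMat]
    rw [e]
    apply opMat_psd
    · intro v w
      simp [inner_sub_left, inner_sub_right, inner_smul_left, inner_smul_right, hAs, hBs, hCs]
    · intro v
      simp [inner_sub_left, inner_smul_left]
      linarith [h v]

lemma op_det_nonneg {A : Euc n →L[ℝ] Euc n}
    (hAs : ∀ v w, ⟪A v, w⟫ = ⟪v, A w⟫) (hA : ∀ v, 0 ≤ ⟪A v, v⟫) : 0 ≤ A.det := by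
  rw [← opMat_det A]
  exact (opMat_psd A hAs hA).det_nonneg

end Dets

section MA
variable {n : ℕ}

lemma op_quad_pos {A : Euc n →L[ℝ] Euc n}
    (hAs : ∀ v w, ⟪A v, w⟫ = ⟪v, A w⟫) (hA : ∀ v, 0 ≤ ⟪A v, v⟫) (hd : A.det ≠ 0)
    (v : Euc n) (hv : v ≠ 0) : ⟪A v, v⟫ ≠ 0 := by
  have hp : (opMat A).PosDef := by
    rw [(opMat_psd A hAs hA).posDef_iff_det_ne_zero, opMat_det]; exact hd
  have h2 := (Matrix.posDef_iff_dotProduct_mulVec.1 hp).2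
    (x := v.ofLp) (by simpa using hv)
  simp only [star_trivial] at h2
  rw [opMat_quad] at h2
  exact h2.ne'

lemma fderiv_grad_pos {φ : Euc n → ℝ} (hφ : ContDiff ℝ 2 φ) (hc : ConvexOn ℝ univ φ)
    (x v : Euc n) : 0 ≤ ⟪fderiv ℝ (gradient φ) x v, v⟫ := by
  rw [← hess_eq_inner hφ]; exact hess_nonneg hφ hc x v

lemma grad_inj {φ : Euc n → ℝ} (hφ : ContDiff ℝ 2 φ) (hc : ConvexOn ℝ univ φ) (x y : Euc n)
    (hx : (fderiv ℝ (gradient φ) x).det ≠ 0) (h : gradient φ x = gradient φ y) : x = y := by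
  by_contra hne
  set v := y - x
  have hv : v ≠ 0 := sub_ne_zero.2 (Ne.symm hne)
  apply op_quad_pos (fderiv_gradient_symm hφ x) (fderiv_grad_pos hφ hc x) hx v hv
  rw [← hess_eq_inner hφ]
  have hd := hasDerivAt_line2 hφ x v 0
  rw [zero_smul, add_zero] at hd
  have hmono : Monotone (fun s : ℝ => ⟪gradient φ (x + s • v), v⟫) := by
    apply monotone_of_deriv_nonneg (fun t => (hasDerivAt_line2 hφ x v t).differentiableAt)
    intro t
    rw [(hasDerivAt_line2 hφ x v t).deriv]
    exact hess_nonneg hφ hc _ _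
  have hy : x + (1:ℝ) • v = y := by simp [v]
  have hconst : ∀ s ∈ Icc (0:ℝ) 1, ⟪gradient φ (x + s • v), v⟫ = ⟪gradient φ x, v⟫ := by
    intro s hs
    have h1 := hmono hs.1
    have h2 := hmono hs.2
    simp only [hy, zero_smul, add_zero, ← h] at h1 h2
    linarith
  have h0 : (0:ℝ) ∈ Icc (0:ℝ) 1 := by simp
  have hd1 := hd.hasDerivWithinAt (s := Icc 0 1)
  have hd2 : HasDerivWithinAt (fun s : ℝ => ⟪gradient φ (x + s • v), v⟫) 0 (Icc 0 1) 0 :=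
    (hasDerivWithinAt_const (0:ℝ) (Icc 0 1) ⟪gradient φ x, v⟫).congr hconst (hconst 0 h0)
  exact (uniqueDiffOn_Icc zero_lt_one 0 h0).eq_deriv _ hd1 hd2

lemma monge_ampere {φ : Euc n → ℝ} (hφ : ContDiff ℝ 2 φ) (hc : ConvexOn ℝ univ φ)
    {ρV ρW : Euc n → ℝ} (hV : Continuous ρV) (hW : Continuous ρW)
    (hVp : ∀ x, 0 < ρV x) (hWp : ∀ x, 0 < ρW x)
    (hpush : Measure.map (fun x => gradient φ x)
      (volume.withDensity fun x => ENNReal.ofReal (ρV x))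
      = volume.withDensity fun x => ENNReal.ofReal (ρW x)) (x : Euc n) :
    (fderiv ℝ (gradient φ) x).det * ρW (gradient φ x) = ρV x := by
  have hG1 := gradient_contDiff hφ
  set G := gradient φ with hG
  have hGc : Continuous G := hG1.continuous
  have hGd : Differentiable ℝ G := hG1.differentiable (by norm_num)
  have hG'c : Continuous (fderiv ℝ G) := hG1.continuous_fderiv (by norm_num)
  have hdc : Continuous (fun x => (fderiv ℝ G x).det) :=
    ContinuousLinearMap.continuous_det.comp hG'c
  have hdn : ∀ x, 0 ≤ (fderiv ℝ G x).det := fun x =>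
    op_det_nonneg (fderiv_gradient_symm hφ x) (fderiv_grad_pos hφ hc x)
  set s := {x | (fderiv ℝ G x).det = 0} with hs
  have hsm : MeasurableSet s := (isClosed_eq hdc continuous_const).measurableSet
  have hVm : Measurable fun x => ENNReal.ofReal (ρV x) := hV.measurable.ennreal_ofReal
  have hWm : Measurable fun x => ENNReal.ofReal (ρW x) := hW.measurable.ennreal_ofReal
  have happ : ∀ A, MeasurableSet A → (volume.withDensity fun x => ENNReal.ofReal (ρV x)) (G ⁻¹' A)
      = (volume.withDensity fun x => ENNReal.ofReal (ρW x)) A := by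
    intro A hA
    rw [← hpush, Measure.map_apply hGc.measurable hA]
  have hs0 : volume s = 0 := by
    have h1 : volume (G '' s) = 0 :=
      addHaar_image_eq_zero_of_det_fderivWithin_eq_zero volume
        (fun x _ => (hGd x).hasFDerivAt.hasFDerivWithinAt) (fun x hx => hx)
    have h2 : (volume.withDensity fun x => ENNReal.ofReal (ρV x)) s = 0 := by
      refine measure_mono_null (t := G ⁻¹' (toMeasurable volume (G '' s))) ?_ ?_
      · intro z hz
        exact subset_toMeasurable _ _ (mem_image_of_mem _ hz)
      · rw [happ _ (measurableSet_toMeasurable _ _)]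
        exact withDensity_absolutelyContinuous _ _ (by rw [measure_toMeasurable]; exact h1)
    refine withDensity_absolutelyContinuous' hVm.aemeasurable ?_ h2
    filter_upwards with z
    simpa using hVp z
  have key : (fun x => ENNReal.ofReal (ρV x)) =ᵐ[volume]
      fun x => ENNReal.ofReal |(fderiv ℝ G x).det| * ENNReal.ofReal (ρW (G x)) := by
    apply ae_eq_of_forall_setLIntegral_eq_of_sigmaFinite hVm
    · exact (hdc.abs.measurable.ennreal_ofReal).mul (hWm.comp hGc.measurable)
    · intro A hA _
      have hAe : (A : Set (Euc n)) =ᵐ[volume] (A \ s : Set (Euc n)) :=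
        (diff_null_ae_eq_self hs0).symm
      rw [setLIntegral_congr hAe, setLIntegral_congr (μ := volume) hAe]
      have hAm : MeasurableSet (A \ s) := hA.diff hsm
      have hinj : InjOn G (A \ s) := fun a ha b _ hab => grad_inj hφ hc a b ha.2 hab
      rw [← lintegral_image_eq_lintegral_abs_det_fderiv_mul volume hAm
        (fun x _ => (hGd x).hasFDerivAt.hasFDerivWithinAt) hinj
        (fun y => ENNReal.ofReal (ρW y))]
      have him : MeasurableSet (G '' (A \ s)) :=
        hAm.image_of_continuousOn_injOn hGc.continuousOn hinj
      rw [← withDensity_apply _ hAm, ← withDensity_apply _ him, ← happ _ him]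
      congr 1
      ext z
      constructor
      · exact fun hz => mem_image_of_mem _ hz
      · rintro ⟨a, ha, haz⟩
        rwa [← grad_inj hφ hc a z ha.2 haz]
  have key2 : ρV = fun x => (fderiv ℝ G x).det * ρW (G x) := by
    apply Measure.eq_of_ae_eq (μ := volume) _ hV (hdc.mul (hW.comp hGc))
    filter_upwards [key] with z hz
    rw [abs_of_nonneg (hdn z), ← ENNReal.ofReal_mul (hdn z)] at hz
    exact (ENNReal.ofReal_eq_ofReal_iff (hVp z).le (mul_nonneg (hdn z) (hWp _).le)).1 hz
  exact (congrFun key2 x).symm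

lemma dense_range_grad {φ : Euc n → ℝ} (hφ : ContDiff ℝ 2 φ)
    {ρV ρW : Euc n → ℝ} (hW : Continuous ρW) (hWp : ∀ x, 0 < ρW x)
    (hpush : Measure.map (fun x => gradient φ x)
      (volume.withDensity fun x => ENNReal.ofReal (ρV x))
      = volume.withDensity fun x => ENNReal.ofReal (ρW x)) :
    DenseRange (gradient φ) := by
  have hGc : Continuous (gradient φ) := (gradient_contDiff hφ).continuous
  rw [DenseRange, dense_iff_inter_open]
  intro U hU hne
  by_contra hcon
  rw [not_nonempty_iff_eq_empty] at hcon
  have h1 : (volume.withDensity fun x => ENNReal.ofReal (ρW x)) U = 0 := by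
    rw [← hpush, Measure.map_apply hGc.measurable hU.measurableSet]
    have : (fun x => gradient φ x) ⁻¹' U = ∅ := by
      ext z
      simp only [mem_preimage, mem_empty_iff_false, iff_false]
      intro hz
      have : gradient φ z ∈ U ∩ range (gradient φ) := ⟨hz, mem_range_self z⟩
      rw [hcon] at this; exact this
    rw [this]; simp
  have h2 : volume U = 0 := by
    refine withDensity_absolutelyContinuous' hW.measurable.ennreal_ofReal.aemeasurable ?_ h1
    filter_upwards with z
    simpa using hWp z
  exact (hU.measure_pos volume hne).ne' h2

end MA

section Mass
variable {n : ℕ}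

lemma tail_integral (hn : 1 ≤ n) (p : ℝ) (hp : (n:ℝ) ≤ p) (r : ℝ) (hr : 0 < r) :
    Integrable (fun x : Euc n => (Ioi r).indicator (fun t : ℝ => t ^ (-(2 * p))) ‖x‖) ∧
    ∫ x : Euc n, (Ioi r).indicator (fun t : ℝ => t ^ (-(2 * p))) ‖x‖
      ≤ unitBallVol n * r ^ ((n:ℝ) - 2 * p) := by
  have : Nonempty (Fin n) := ⟨⟨0, hn⟩⟩
  have hn1 : (1:ℝ) ≤ n := by exact_mod_cast hn
  have hdim : Module.finrank ℝ (Euc n) = n := by simp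
  have hfun : EqOn (fun y : ℝ => y ^ (n - 1) • (Ioi r).indicator (fun t : ℝ => t ^ (-(2 * p))) y)
     ((Ioi r).indicator (fun t : ℝ => t ^ ((n:ℝ) - 1 - 2 * p))) (Ioi 0) := by
    intro y hy
    by_cases h : y ∈ Ioi r
    · simp only [indicator_of_mem h, smul_eq_mul]
      rw [← Real.rpow_natCast, ← Real.rpow_add hy]
      congr 1
      rw [Nat.cast_sub hn]; push_cast; ring
    · simp [indicator_of_notMem h]
  have ha : (n:ℝ) - 1 - 2 * p < -1 := by linarith
  constructor
  · rw [integrable_fun_norm_addHaar volume (f := (Ioi r).indicator (fun t : ℝ => t ^ (-(2 * p)))), hdim,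
      integrableOn_congr_fun hfun measurableSet_Ioi]
    have := (integrable_indicator_iff measurableSet_Ioi).2 (integrableOn_Ioi_rpow_of_lt ha hr)
    exact this.integrableOn
  · rw [integral_fun_norm_addHaar volume (f := (Ioi r).indicator (fun t : ℝ => t ^ (-(2 * p)))), hdim,
      setIntegral_congr_fun measurableSet_Ioi hfun, setIntegral_indicator measurableSet_Ioi,
      inter_eq_right.2 (Ioi_subset_Ioi hr.le), integral_Ioi_rpow_of_lt ha hr]
    have e1 : (n:ℝ) - 1 - 2 * p + 1 = (n:ℝ) - 2 * p := by ring
    rw [e1]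
    have hω : (0:ℝ) ≤ volume.real (ball (0 : Euc n) 1) := measureReal_nonneg
    have hω' : unitBallVol n = volume.real (ball (0 : Euc n) 1) := rfl
    rw [hω', nsmul_eq_mul, smul_eq_mul]
    have hpos : 0 < r ^ ((n:ℝ) - 2 * p) := Real.rpow_pos_of_pos hr _
    have h2 : 0 < 2 * p - n := by linarith
    have : -r ^ ((n:ℝ) - 2 * p) / ((n:ℝ) - 2 * p) = r ^ ((n:ℝ) - 2 * p) / (2 * p - n) := by
      rw [neg_div, ← div_neg, neg_sub]
    rw [this]
    have h3 : (n:ℝ) / (2 * p - n) ≤ 1 := by rw [div_le_one h2]; linarith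
    calc _ = (n:ℝ) / (2 * p - n) * (volume.real (ball (0 : Euc n) 1) * r ^ ((n:ℝ) - 2 * p)) := by
          field_simp
      _ ≤ 1 * _ := by gcongr
      _ = _ := one_mul _

lemma unitBallVol_pos : 0 < unitBallVol n := by
  unfold unitBallVol
  exact ENNReal.toReal_pos (measure_ball_pos _ _ one_pos).ne' measure_ball_lt_top.ne

lemma ball_vol (z : Euc n) (s : ℝ) (hs : 0 < s) :
    volume (ball z s) = ENNReal.ofReal (unitBallVol n * s ^ (n:ℝ)) := by
  rw [Measure.addHaar_ball_of_pos _ _ hs, unitBallVol, mul_comm,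
    ENNReal.ofReal_mul ENNReal.toReal_nonneg, ENNReal.ofReal_toReal measure_ball_lt_top.ne]
  simp

/-- Two sided quadratic bounds. -/
structure QB (U : Euc n → ℝ) (p c0 C0 : ℝ) : Prop where
  cont : Continuous U
  pn : (n:ℝ) ≤ p
  p0 : 0 < p
  c0p : 0 < c0
  C0p : 0 < C0
  lo : ∀ x, c0 * (p + ‖x‖ ^ 2) ≤ p + U x
  up : ∀ x, p + U x ≤ C0 * (p + ‖x‖ ^ 2)
  int : Integrable fun x : Euc n => (1 + U x / p) ^ (-p)

variable {U : Euc n → ℝ} {p c0 C0 : ℝ}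

lemma QB.base_pos (h : QB U p c0 C0) (x : Euc n) : 0 < 1 + ‖x‖ ^ 2 / p := by
  have := h.p0; positivity

lemma QB.lo' (h : QB U p c0 C0) (x : Euc n) : c0 * (1 + ‖x‖ ^ 2 / p) ≤ 1 + U x / p := by
  have := h.p0
  have h1 : c0 * (1 + ‖x‖ ^ 2 / p) = (c0 * (p + ‖x‖ ^ 2)) / p := by field_simp
  have h2 : 1 + U x / p = (p + U x) / p := by field_simp
  rw [h1, h2]; gcongr; exact h.lo x

lemma QB.up' (h : QB U p c0 C0) (x : Euc n) : 1 + U x / p ≤ C0 * (1 + ‖x‖ ^ 2 / p) := by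
  have := h.p0
  have h1 : C0 * (1 + ‖x‖ ^ 2 / p) = (C0 * (p + ‖x‖ ^ 2)) / p := by field_simp
  have h2 : 1 + U x / p = (p + U x) / p := by field_simp
  rw [h1, h2]; gcongr; exact h.up x

lemma QB.pos' (h : QB U p c0 C0) (x : Euc n) : 0 < 1 + U x / p :=
  lt_of_lt_of_le (mul_pos h.c0p (h.base_pos x)) (h.lo' x)

lemma QB.dlo (h : QB U p c0 C0) (x : Euc n) :
    C0 ^ (-p) * (1 + ‖x‖ ^ 2 / p) ^ (-p) ≤ (1 + U x / p) ^ (-p) := by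
  rw [← Real.mul_rpow h.C0p.le (h.base_pos x).le]
  exact Real.rpow_le_rpow_of_nonpos (h.pos' x) (h.up' x) (by have := h.p0; linarith)

lemma QB.dup (h : QB U p c0 C0) (x : Euc n) :
    (1 + U x / p) ^ (-p) ≤ c0 ^ (-p) * (1 + ‖x‖ ^ 2 / p) ^ (-p) := by
  rw [← Real.mul_rpow h.c0p.le (h.base_pos x).le]
  exact Real.rpow_le_rpow_of_nonpos (mul_pos h.c0p (h.base_pos x)) (h.lo' x)
    (by have := h.p0; linarith)

lemma QB.cont1 (h : QB U p c0 C0) : Continuous fun x : Euc n => (1 + ‖x‖ ^ 2 / p) ^ (-p) :=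
  Continuous.rpow_const (by fun_prop) (fun x => Or.inl (h.base_pos x).ne')

lemma QB.cont2 (h : QB U p c0 C0) : Continuous fun x : Euc n => (1 + U x / p) ^ (-p) := by
  have := h.cont
  exact Continuous.rpow_const (by fun_prop) (fun x => Or.inl (h.pos' x).ne')

lemma QB.int1 (h : QB U p c0 C0) : Integrable fun x : Euc n => (1 + ‖x‖ ^ 2 / p) ^ (-p) := by
  have hC : 0 < C0 ^ (-p) := Real.rpow_pos_of_pos h.C0p _
  refine (h.int.const_mul (C0 ^ (-p))⁻¹).mono' h.cont1.aestronglyMeasurable ?_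
  filter_upwards with x
  rw [Real.norm_of_nonneg (Real.rpow_nonneg (h.base_pos x).le _)]
  rw [inv_mul_eq_div, le_div_iff₀ hC, mul_comm]
  exact h.dlo x

lemma QB.I_pos (h : QB U p c0 C0) : 0 < Ipol n p := by
  apply integral_pos_of_integrable_nonneg_nonzero h.cont1 h.int1 (x := 0)
  · intro x; exact Real.rpow_nonneg (h.base_pos x).le _
  · exact (Real.rpow_pos_of_pos (h.base_pos 0) _).ne'

lemma QB.Z_lo (h : QB U p c0 C0) : C0 ^ (-p) * Ipol n p ≤ Znorm U p := by
  unfold Ipol Znorm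
  rw [← integral_const_mul]
  exact integral_mono (h.int1.const_mul _) h.int h.dlo

lemma QB.Z_up (h : QB U p c0 C0) : Znorm U p ≤ c0 ^ (-p) * Ipol n p := by
  unfold Ipol Znorm
  rw [← integral_const_mul]
  exact integral_mono h.int (h.int1.const_mul _) h.dup

lemma QB.Z_pos (h : QB U p c0 C0) : 0 < Znorm U p :=
  lt_of_lt_of_le (mul_pos (Real.rpow_pos_of_pos h.C0p _) h.I_pos) h.Z_lo

/-- the density -/
def rho (U : Euc n → ℝ) (p : ℝ) (x : Euc n) : ℝ := (Znorm U p)⁻¹ * (1 + U x / p) ^ (-p)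

lemma QB.rho_pos (h : QB U p c0 C0) (x : Euc n) : 0 < rho U p x :=
  mul_pos (inv_pos.2 h.Z_pos) (Real.rpow_pos_of_pos (h.pos' x) _)

lemma QB.rho_cont (h : QB U p c0 C0) : Continuous (rho U p) := by
  unfold rho; exact continuous_const.mul h.cont2

lemma QB.rho_up (h : QB U p c0 C0) (x : Euc n) :
    rho U p x ≤ (C0 / c0) ^ p * (Ipol n p)⁻¹ * (1 + ‖x‖ ^ 2 / p) ^ (-p) := by
  have hC : 0 < C0 ^ (-p) := Real.rpow_pos_of_pos h.C0p _
  have hI := h.I_pos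
  have hb := Real.rpow_pos_of_pos (h.base_pos x) (-p)
  have h1 : (Znorm U p)⁻¹ ≤ (C0 ^ (-p) * Ipol n p)⁻¹ := inv_anti₀ (by positivity) h.Z_lo
  unfold rho
  calc _ ≤ (C0 ^ (-p) * Ipol n p)⁻¹ * (c0 ^ (-p) * (1 + ‖x‖ ^ 2 / p) ^ (-p)) := by
        gcongr
        · exact Real.rpow_nonneg (h.pos' x).le _
        · exact h.dup x
    _ = _ := by
        rw [Real.div_rpow h.C0p.le h.c0p.le, Real.rpow_neg h.C0p.le, Real.rpow_neg h.c0p.le]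
        have := Real.rpow_pos_of_pos h.C0p p
        have := Real.rpow_pos_of_pos h.c0p p
        field_simp

lemma QB.rho_lo (h : QB U p c0 C0) (x : Euc n) :
    ((C0 / c0) ^ p)⁻¹ * (Ipol n p)⁻¹ * (1 + ‖x‖ ^ 2 / p) ^ (-p) ≤ rho U p x := by
  have hC : 0 < c0 ^ (-p) := Real.rpow_pos_of_pos h.c0p _
  have hI := h.I_pos
  have hb := Real.rpow_pos_of_pos (h.base_pos x) (-p)
  have hZ := h.Z_pos
  have hc1 := Real.rpow_pos_of_pos h.C0p (-p)
  have h1 : (c0 ^ (-p) * Ipol n p)⁻¹ ≤ (Znorm U p)⁻¹ := inv_anti₀ hZ h.Z_up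
  unfold rho
  calc _ = (c0 ^ (-p) * Ipol n p)⁻¹ * (C0 ^ (-p) * (1 + ‖x‖ ^ 2 / p) ^ (-p)) := by
        rw [Real.div_rpow h.C0p.le h.c0p.le, Real.rpow_neg h.C0p.le, Real.rpow_neg h.c0p.le]
        have := Real.rpow_pos_of_pos h.C0p p
        have := Real.rpow_pos_of_pos h.c0p p
        field_simp
    _ ≤ _ := by
        gcongr
        exact h.dlo x

lemma muUP_apply (S : Set (Euc n)) (hS : MeasurableSet S) :
    muUP U p S = ∫⁻ x in S, ENNReal.ofReal (rho U p x) := by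
  unfold muUP rho
  rw [withDensity_apply _ hS]

lemma QB.mass_up (h : QB U p c0 C0) (hn : 1 ≤ n) (r : ℝ) (hr : 0 < r) :
    muUP U p {x | r < ‖x‖} ≤ ENNReal.ofReal
      ((C0 / c0) ^ p * (Ipol n p)⁻¹ * p ^ p * (unitBallVol n * r ^ ((n:ℝ) - 2 * p))) := by
  have hS : MeasurableSet {x : Euc n | r < ‖x‖} := (isOpen_lt continuous_const continuous_norm).measurableSet
  obtain ⟨ti, te⟩ := tail_integral hn p h.pn r hr
  have hp := h.p0
  set k := (C0 / c0) ^ p * (Ipol n p)⁻¹ * p ^ p with hk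
  have hk0 : 0 ≤ k := by
    have := Real.rpow_pos_of_pos (div_pos h.C0p h.c0p) p
    have := h.I_pos
    have := Real.rpow_pos_of_pos hp p
    positivity
  rw [muUP_apply _ hS, ← lintegral_indicator hS]
  calc _ ≤ ∫⁻ x : Euc n, ENNReal.ofReal (k * (Ioi r).indicator (fun t : ℝ => t ^ (-(2 * p))) ‖x‖) := by
        apply lintegral_mono
        intro x
        by_cases hx : r < ‖x‖
        · have hx1 : x ∈ {x : Euc n | r < ‖x‖} := hx
          have hx2 : ‖x‖ ∈ Ioi r := hx
          simp only [indicator_of_mem hx1, indicator_of_mem hx2]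
          apply ENNReal.ofReal_le_ofReal
          refine (h.rho_up x).trans ?_
          have hx0 : 0 < ‖x‖ := hr.trans hx
          have : (1 + ‖x‖ ^ 2 / p) ^ (-p) ≤ (‖x‖ ^ 2 / p) ^ (-p) :=
            Real.rpow_le_rpow_of_nonpos (by positivity) (by linarith) (by linarith)
          have e : (‖x‖ ^ 2 / p) ^ (-p) = p ^ p * ‖x‖ ^ (-(2 * p)) := by
            rw [Real.div_rpow (by positivity) hp.le, ← Real.rpow_natCast, ← Real.rpow_mul hx0.le,
              Real.rpow_neg hp.le p, div_inv_eq_mul, mul_comm]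
            congr 2; push_cast; ring
          rw [e] at this
          rw [hk, mul_assoc _ (p ^ p)]
          gcongr
          have := Real.rpow_pos_of_pos (div_pos h.C0p h.c0p) p
          have := h.I_pos
          positivity
        · have hx1 : x ∉ {x : Euc n | r < ‖x‖} := hx
          simp [indicator_of_notMem hx1]
    _ = ENNReal.ofReal (∫ x : Euc n, k * (Ioi r).indicator (fun t : ℝ => t ^ (-(2 * p))) ‖x‖) := by
        rw [ofReal_integral_eq_lintegral_ofReal (ti.const_mul k)]
        filter_upwards with x
        apply mul_nonneg hk0
        apply indicator_nonneg
        intro t ht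
        exact Real.rpow_nonneg (hr.le.trans (le_of_lt ht)) _
    _ ≤ _ := by
        apply ENNReal.ofReal_le_ofReal
        rw [integral_const_mul]
        gcongr

lemma QB.mass_lo (h : QB U p c0 C0) (R : ℝ) (hR : Real.sqrt p ≤ R) (z v : Euc n) (hz : ‖z‖ ≤ R)
    (hv : ‖v‖ = 1) :
    ENNReal.ofReal (((C0 / c0) ^ p)⁻¹ * (Ipol n p)⁻¹ * (101 * R ^ 2 / p) ^ (-p)
        * (unitBallVol n * (3 * R) ^ (n:ℝ)))
      ≤ muUP U p (ball (z + (6 * R) • v) (3 * R)) := by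
  have hp := h.p0
  have hR0 : 0 < R := (Real.sqrt_pos.2 hp).trans_le hR
  have hR2 : p ≤ R ^ 2 := (Real.sqrt_le_left hR0.le).1 hR
  have hk : 0 ≤ ((C0 / c0) ^ p)⁻¹ * (Ipol n p)⁻¹ := by
    have := Real.rpow_pos_of_pos (div_pos h.C0p h.c0p) p
    have := h.I_pos
    positivity
  rw [ENNReal.ofReal_mul (mul_nonneg hk (by positivity)), ← ball_vol (z + (6 * R) • v) (3 * R) (by positivity),
    muUP_apply _ measurableSet_ball, ← setLIntegral_const]
  apply setLIntegral_mono' measurableSet_ball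
  intro x hx
  apply ENNReal.ofReal_le_ofReal
  refine le_trans ?_ (h.rho_lo x)
  have hx' : ‖x‖ ≤ 10 * R := by
    rw [mem_ball, dist_eq_norm] at hx
    have e : x = (x - (z + (6 * R) • v)) + (z + (6 * R) • v) := by abel
    calc ‖x‖ = ‖(x - (z + (6 * R) • v)) + (z + (6 * R) • v)‖ := by rw [← e]
      _ ≤ ‖x - (z + (6 * R) • v)‖ + (‖z‖ + ‖(6 * R) • v‖) :=
        (norm_add_le _ _).trans (by gcongr; exact norm_add_le _ _)
      _ ≤ 10 * R := by
        rw [norm_smul, hv, Real.norm_of_nonneg (by positivity)]; linarith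
  apply mul_le_mul_of_nonneg_left _ hk
  apply Real.rpow_le_rpow_of_nonpos (h.base_pos x) _ (by linarith)
  have : ‖x‖ ^ 2 ≤ 100 * R ^ 2 := by
    have := pow_le_pow_left₀ (norm_nonneg x) hx' 2
    linarith
  rw [le_div_iff₀ hp]
  have : (1 + ‖x‖ ^ 2 / p) * p = p + ‖x‖ ^ 2 := by field_simp
  rw [this]; linarith

end Mass

section Growth
variable {n : ℕ}

lemma mass_alg (N p q a b Ip Iq ω R t : ℝ) (hp : 0 < p) (hq : 0 < q) (ha : 0 < a) (hb : 0 < b)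
    (hIp : 0 < Ip) (hIq : 0 < Iq) (hω : 0 < ω) (hR : 0 < R) (ht : 0 < t)
    (h : a⁻¹ * Ip⁻¹ * (101 * R ^ 2 / p) ^ (-p) * (ω * (3 * R) ^ N)
      ≤ b * Iq⁻¹ * q ^ q * (ω * t ^ (N - 2 * q))) :
    t ^ (2 * q - N) ≤ a * b * (Ip / Iq) * q ^ q * p ^ (-p) * 101 ^ p * 3 ^ (-N) * R ^ (2 * p - N) := by
  have e1 : (101 * R ^ 2 / p) ^ (-p) = (101 ^ p)⁻¹ * (p ^ (-p))⁻¹ * (R ^ (2 * p))⁻¹ := by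
    rw [Real.div_rpow (by positivity) hp.le, Real.mul_rpow (by norm_num) (by positivity),
      Real.rpow_neg (by norm_num), Real.rpow_neg (by positivity) p, ← Real.rpow_natCast, ← Real.rpow_mul hR.le]
    push_cast
    rw [div_eq_mul_inv]; ring
  have e2 : (3 * R) ^ N = (3 ^ (-N))⁻¹ * R ^ N := by
    rw [Real.mul_rpow (by norm_num) hR.le, Real.rpow_neg (by norm_num), inv_inv]
  have e3 : t ^ (N - 2 * q) = (t ^ (2 * q - N))⁻¹ := by
    rw [← Real.rpow_neg ht.le]; congr 1; ring
  have e4 : R ^ (2 * p - N) = R ^ (2 * p) / R ^ N := Real.rpow_sub hR _ _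
  rw [e1, e2, e3] at h
  rw [e4]
  have p1 := Real.rpow_pos_of_pos (show (0:ℝ) < 101 by norm_num) p
  have p2 := Real.rpow_pos_of_pos hp (-p)
  have p3 := Real.rpow_pos_of_pos hR (2 * p)
  have p4 := Real.rpow_pos_of_pos hR N
  have p5 := Real.rpow_pos_of_pos (show (0:ℝ) < 3 by norm_num) (-N)
  have p6 := Real.rpow_pos_of_pos ht (2 * q - N)
  have p7 := Real.rpow_pos_of_pos hq q
  generalize (101:ℝ) ^ p = x1 at *
  generalize p ^ (-p) = x2 at *
  generalize R ^ (2 * p) = x3 at *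
  generalize R ^ N = x4 at *
  generalize (3:ℝ) ^ (-N) = x5 at *
  generalize t ^ (2 * q - N) = x6 at *
  generalize q ^ q = x7 at *
  have f : 0 < a * Ip * x1 * x2 * x3 * x5 * x6 / (ω * x4) := by positivity
  have := mul_le_mul_of_nonneg_left h f.le
  calc x6 = a * Ip * x1 * x2 * x3 * x5 * x6 / (ω * x4) * (a⁻¹ * Ip⁻¹ * (x1⁻¹ * x2⁻¹ * x3⁻¹) * (ω * (x5⁻¹ * x4))) := by
        field_simp
    _ ≤ _ := this
    _ = _ := by field_simp

/-- All the standing assumptions. -/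
structure Setup (V W φ : Euc n → ℝ) (d D cV CV cW CW : ℝ) : Prop where
  hn : 1 ≤ n
  qV : QB V d cV CV
  qW : QB W D cW CW
  reg : ContDiff ℝ 2 φ
  conv : ConvexOn ℝ univ φ
  push : Measure.map (fun x => gradient φ x) (muUP V d) = muUP W D

variable {V W φ : Euc n → ℝ} {d D cV CV cW CW : ℝ}

lemma Setup.pre (h : Setup V W φ d D cV CV cW CW) {S : Set (Euc n)} (hS : MeasurableSet S) :
    muUP W D S = muUP V d (gradient φ ⁻¹' S) := by
  rw [← h.push, Measure.map_apply (gradient_contDiff h.reg).continuous.measurable hS]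

/-- geometric step for monotone maps -/
lemma geom_step (x x0 y y0 : Euc n) (R : ℝ) (hR : 0 < R) (hy0 : y0 ≠ 0)
    (hm : ⟪y0, x - x0⟫ ≤ ⟪y, x - x0⟫)
    (hx : x ∈ ball (x0 + (6 * R) • (‖y0‖⁻¹ • y0)) (3 * R)) : ‖y0‖ / 3 < ‖y‖ := by
  rw [mem_ball, dist_eq_norm] at hx
  have hs : 0 < ‖y0‖ := norm_pos_iff.2 hy0
  set v := ‖y0‖⁻¹ • y0 with hv
  have hvn : ‖v‖ = 1 := by rw [hv, norm_smul, norm_inv, norm_norm, inv_mul_cancel₀ hs.ne']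
  have e : x - x0 = (x - (x0 + (6 * R) • v)) + (6 * R) • v := by abel
  have h1 : ‖x - x0‖ < 9 * R := by
    rw [e]
    refine (norm_add_le _ _).trans_lt ?_
    rw [norm_smul, hvn, Real.norm_of_nonneg (by positivity)]; linarith
  have h2 : ⟪y0, v⟫ = ‖y0‖ := by
    rw [hv, inner_smul_right, real_inner_self_eq_norm_sq]; field_simp
  have h3 : 3 * R * ‖y0‖ < ⟪y0, x - x0⟫ := by
    rw [e, inner_add_right, inner_smul_right, h2]
    have := abs_real_inner_le_norm y0 (x - (x0 + (6 * R) • v))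
    have h4 := (abs_le.1 this).1
    nlinarith
  have h5 : ⟪y, x - x0⟫ ≤ ‖y‖ * ‖x - x0‖ := real_inner_le_norm _ _
  have h6 : ‖y‖ * ‖x - x0‖ ≤ ‖y‖ * (9 * R) := by gcongr
  have h7 : 3 * R * ‖y0‖ < 3 * R * (3 * ‖y‖) := by linarith
  have := lt_of_mul_lt_mul_left h7 (by positivity)
  linarith

lemma ratio_pow_pos {c C p : ℝ} (hc : 0 < c) (hC : 0 < C) : 0 < (C / c) ^ p :=
  Real.rpow_pos_of_pos (div_pos hC hc) p

lemma Setup.fwd (h : Setup V W φ d D cV CV cW CW) (x0 : Euc n) (hy : gradient φ x0 ≠ 0) :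
    (‖gradient φ x0‖ / 3) ^ (2 * D - n) ≤ (CV / cV) ^ d * (CW / cW) ^ D * (Ipol n d / Ipol n D)
      * D ^ D * d ^ (-d) * 101 ^ d * 3 ^ (-(n:ℝ)) * (max ‖x0‖ (Real.sqrt d)) ^ (2 * d - n) := by
  set y0 := gradient φ x0 with hy0
  set R := max ‖x0‖ (Real.sqrt d) with hRdef
  have hd := h.qV.p0
  have hs : 0 < ‖y0‖ := norm_pos_iff.2 hy
  have hR : 0 < R := lt_of_lt_of_le (Real.sqrt_pos.2 hd) (le_max_right _ _)
  have hv : ‖‖y0‖⁻¹ • y0‖ = 1 := by rw [norm_smul, norm_inv, norm_norm, inv_mul_cancel₀ hs.ne']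
  have h1 := h.qV.mass_lo R (le_max_right _ _) x0 (‖y0‖⁻¹ • y0) (le_max_left _ _) hv
  have h2 := h.qW.mass_up h.hn (‖y0‖ / 3) (by positivity)
  rw [h.pre (isOpen_lt continuous_const continuous_norm).measurableSet] at h2
  have h3 : ball (x0 + (6 * R) • (‖y0‖⁻¹ • y0)) (3 * R) ⊆ gradient φ ⁻¹' {y | ‖y0‖ / 3 < ‖y‖} := by
    intro x hx
    exact geom_step x x0 (gradient φ x) y0 R hR hy (grad_mono h.reg h.conv x0 x) hx
  have h4 := (h1.trans (measure_mono h3)).trans h2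
  have pa := ratio_pow_pos (p := d) h.qV.c0p h.qV.C0p
  have pb := ratio_pow_pos (p := D) h.qW.c0p h.qW.C0p
  have pω := unitBallVol_pos (n := n)
  have hD := h.qW.p0
  have pI := h.qW.I_pos
  have pI2 := h.qV.I_pos
  rw [ENNReal.ofReal_le_ofReal_iff (by positivity)] at h4
  exact mass_alg n d D _ _ _ _ _ R _ hd hD pa pb pI2 pI pω hR (by positivity) h4

lemma Setup.rev (h : Setup V W φ d D cV CV cW CW) (x0 : Euc n) (hx0 : x0 ≠ 0) :
    (‖x0‖ / 3) ^ (2 * d - n) ≤ (CW / cW) ^ D * (CV / cV) ^ d * (Ipol n D / Ipol n d)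
      * d ^ d * D ^ (-D) * 101 ^ D * 3 ^ (-(n:ℝ)) * (max ‖gradient φ x0‖ (Real.sqrt D)) ^ (2 * D - n) := by
  set y0 := gradient φ x0 with hy0
  set R := max ‖y0‖ (Real.sqrt D) with hRdef
  have hd := h.qV.p0
  have hD := h.qW.p0
  have hs : 0 < ‖x0‖ := norm_pos_iff.2 hx0
  have hR : 0 < R := lt_of_lt_of_le (Real.sqrt_pos.2 hD) (le_max_right _ _)
  have hv : ‖‖x0‖⁻¹ • x0‖ = 1 := by rw [norm_smul, norm_inv, norm_norm, inv_mul_cancel₀ hs.ne']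
  have h1 := h.qW.mass_lo R (le_max_right _ _) y0 (‖x0‖⁻¹ • x0) (le_max_left _ _) hv
  have h2 := h.qV.mass_up h.hn (‖x0‖ / 3) (by positivity)
  rw [h.pre measurableSet_ball] at h1
  have h3 : gradient φ ⁻¹' (ball (y0 + (6 * R) • (‖x0‖⁻¹ • x0)) (3 * R)) ⊆ {x | ‖x0‖ / 3 < ‖x‖} := by
    intro x hx
    refine geom_step (gradient φ x) y0 x x0 R hR hx0 ?_ hx
    have := grad_mono h.reg h.conv x0 x
    have e : ⟪x, gradient φ x - y0⟫ - ⟪x0, gradient φ x - y0⟫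
        = ⟪gradient φ x, x - x0⟫ - ⟪y0, x - x0⟫ := by
      rw [← inner_sub_left, ← inner_sub_left, real_inner_comm]
    rw [← sub_nonneg, e]
    linarith
  have h4 := (h1.trans (measure_mono h3)).trans h2
  have pa := ratio_pow_pos (p := d) h.qV.c0p h.qV.C0p
  have pb := ratio_pow_pos (p := D) h.qW.c0p h.qW.C0p
  have pω := unitBallVol_pos (n := n)
  have pI := h.qW.I_pos
  have pI2 := h.qV.I_pos
  rw [ENNReal.ofReal_le_ofReal_iff (by positivity)] at h4
  exact mass_alg n D d _ _ _ _ _ R _ hD hd pb pa pI pI2 pω hR (by positivity) h4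

/-- the sharp global bound -/
lemma Setup.grad_K (h : Setup V W φ d D cV CV cW CW) (hdD : d ≤ D) (K : ℝ)
    (hK : K = 3 * ((CV / cV) ^ d * (CW / cW) ^ D
        * (5 / 4) ^ d * 10 ^ (2 * d) * 3 ^ (-(n : ℝ)) * (D / d) ^ D
        * (Ipol n d / Ipol n D)) ^ (1 / (2 * D - n))) (x0 : Euc n) :
    ‖gradient φ x0‖ ≤ K * max ‖x0‖ (Real.sqrt d) := by
  have hd := h.qV.p0
  have hD := h.qW.p0
  have hn1 : (1:ℝ) ≤ n := by exact_mod_cast h.hn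
  have hDn := h.qW.pn
  have pa := ratio_pow_pos (p := d) h.qV.c0p h.qV.C0p
  have pb := ratio_pow_pos (p := D) h.qW.c0p h.qW.C0p
  have pI := h.qW.I_pos
  have pI2 := h.qV.I_pos
  have p1 := Real.rpow_pos_of_pos (show (0:ℝ) < 5/4 by norm_num) d
  have p2 := Real.rpow_pos_of_pos (show (0:ℝ) < 10 by norm_num) (2 * d)
  have p3 := Real.rpow_pos_of_pos (show (0:ℝ) < 3 by norm_num) (-(n:ℝ))
  have p4 := Real.rpow_pos_of_pos (div_pos hD hd) D
  set R := max ‖x0‖ (Real.sqrt d) with hRdef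
  have hRd : Real.sqrt d ≤ R := le_max_right _ _
  have hR : 0 < R := lt_of_lt_of_le (Real.sqrt_pos.2 hd) (le_max_right _ _)
  have hR2 : d ≤ R ^ 2 := (Real.sqrt_le_left hR.le).1 hRd
  set E := (CV / cV) ^ d * (CW / cW) ^ D
        * (5 / 4) ^ d * 10 ^ (2 * d) * 3 ^ (-(n : ℝ)) * (D / d) ^ D
        * (Ipol n d / Ipol n D) with hE
  have hE0 : 0 < E := by positivity
  by_cases hy : gradient φ x0 = 0
  · rw [hy, norm_zero, hK]; positivity
  have hs : 0 < ‖gradient φ x0‖ := norm_pos_iff.2 hy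
  have h1 := h.fwd x0 hy
  have he : 0 < 2 * D - n := by linarith
  have h2 : (‖gradient φ x0‖ / 3) ^ (2 * D - n) ≤ E * R ^ (2 * D - n) := by
    refine h1.trans ?_
    have a1 : (101:ℝ) ^ d ≤ (5 / 4) ^ d * 10 ^ (2 * d) := by
      rw [Real.rpow_mul (by norm_num) 2 d, ← Real.mul_rpow (by norm_num) (by norm_num)]
      apply Real.rpow_le_rpow (by norm_num) _ hd.le
      norm_num
    have a2 : R ^ (2 * d - n) ≤ R ^ (2 * D - n) * d ^ (-(D - d)) := by
      have : 2 * d - n = (2 * D - n) + (2:ℝ) * (-(D - d)) := by ring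
      rw [this, Real.rpow_add hR, Real.rpow_mul hR.le]
      apply mul_le_mul_of_nonneg_left _ (by positivity)
      apply Real.rpow_le_rpow_of_nonpos hd _ (by linarith)
      exact_mod_cast hR2
    have a3 : D ^ D * d ^ (-d) * d ^ (-(D - d)) = (D / d) ^ D := by
      rw [mul_assoc, ← Real.rpow_add hd, Real.div_rpow hD.le hd.le, div_eq_mul_inv,
        ← Real.rpow_neg hd.le]
      congr 2; ring
    have p5 := Real.rpow_pos_of_pos hD D
    have p6 := Real.rpow_pos_of_pos hd (-d)
    calc _ ≤ (CV / cV) ^ d * (CW / cW) ^ D * (Ipol n d / Ipol n D)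
      * D ^ D * d ^ (-d) * ((5 / 4) ^ d * 10 ^ (2 * d)) * 3 ^ (-(n:ℝ)) * (R ^ (2 * D - n) * d ^ (-(D - d))) := by
          gcongr
      _ = _ := by rw [hE, ← a3]; ring
  have h3 : ‖gradient φ x0‖ / 3 ≤ E ^ (1 / (2 * D - n)) * R := by
    have h4 := Real.rpow_le_rpow (by positivity) h2 (show 0 ≤ 1 / (2 * D - n) by positivity)
    rw [Real.mul_rpow hE0.le (by positivity), ← Real.rpow_mul (by positivity),
      ← Real.rpow_mul hR.le, mul_one_div_cancel he.ne', Real.rpow_one, Real.rpow_one] at h4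
    exact h4
  rw [hK]; linarith

end Growth

section Growth2
variable {n : ℕ}
variable {V W φ : Euc n → ℝ} {d D cV CV cW CW : ℝ}

lemma conj_lower {φ : Euc n → ℝ} (hφ : ContDiff ℝ 2 φ) (hc : ConvexOn ℝ univ φ)
    (hdense : DenseRange (gradient φ)) (Z : ℝ → ℝ) (hZ : Continuous Z)
    (hz : ∀ z, ‖z‖ ≤ Z ‖gradient φ z‖) (m k : ℝ) (hk : 0 ≤ k) (hm : ∀ z, m - k * ‖z‖ ≤ φ z)
    (x w : Euc n) : m + ⟪w, x⟫ - (k + ‖w‖) * Z ‖w‖ ≤ φ x := by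
  have hcl : IsClosed {w : Euc n | m + ⟪w, x⟫ - (k + ‖w‖) * Z ‖w‖ ≤ φ x} := by
    apply isClosed_le _ continuous_const
    have h1 : Continuous fun w : Euc n => Z ‖w‖ := hZ.comp continuous_norm
    fun_prop
  have := hdense.induction_on (p := fun w : Euc n => m + ⟪w, x⟫ - (k + ‖w‖) * Z ‖w‖ ≤ φ x) w hcl
  apply this
  intro z
  have h1 := grad_ineq hφ hc z x
  rw [inner_sub_right] at h1
  have h2 : ⟪gradient φ z, z⟫ ≤ ‖gradient φ z‖ * ‖z‖ := real_inner_le_norm _ _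
  have h3 := hm z
  have h4 : (k + ‖gradient φ z‖) * ‖z‖ ≤ (k + ‖gradient φ z‖) * Z ‖gradient φ z‖ :=
    mul_le_mul_of_nonneg_left (hz z) (by positivity)
  have : (k + ‖gradient φ z‖) * ‖z‖ = k * ‖z‖ + ‖gradient φ z‖ * ‖z‖ := by ring
  linarith

lemma Setup.dense (h : Setup V W φ d D cV CV cW CW) : DenseRange (gradient φ) := by
  have := h.push
  unfold muUP at this
  exact dense_range_grad h.reg h.qW.rho_cont h.qW.rho_pos this

lemma Setup.ma (h : Setup V W φ d D cV CV cW CW) (x : Euc n) :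
    (fderiv ℝ (gradient φ) x).det * rho W D (gradient φ x) = rho V d x := by
  have := h.push
  unfold muUP at this
  exact monge_ampere h.reg h.conv h.qV.rho_cont h.qW.rho_cont h.qV.rho_pos h.qW.rho_pos this x

/-- Growth facts used for the maximum principle. -/
lemma Setup.growth (h : Setup V W φ d D cV CV cW CW) (K : ℝ) (hK0 : 0 ≤ K)
    (hK : ∀ x, ‖gradient φ x‖ ≤ K * max ‖x‖ (Real.sqrt d)) :
    ∃ m G : ℝ, 0 < G ∧ (∀ x, m ≤ φ x) ∧ (∀ R : ℝ, 0 ≤ R → ∃ C, ∀ x, R * ‖x‖ - C ≤ φ x) ∧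
      ∀ x, ‖gradient φ x‖ ^ 2 ≤ G * (1 + φ x - m) := by
  have hd := h.qV.p0
  have hD := h.qW.p0
  have hn1 : (1:ℝ) ≤ n := by exact_mod_cast h.hn
  have hDn := h.qW.pn
  have hdn := h.qV.pn
  have pa := ratio_pow_pos (p := d) h.qV.c0p h.qV.C0p
  have pb := ratio_pow_pos (p := D) h.qW.c0p h.qW.C0p
  have pI := h.qW.I_pos
  have pI2 := h.qV.I_pos
  obtain ⟨a, ha⟩ : ∃ a, a = 2 * D - n := ⟨_, rfl⟩
  obtain ⟨b, hb⟩ : ∃ b, b = 2 * d - n := ⟨_, rfl⟩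
  have ha0 : 0 < a := by linarith
  have hb0 : 0 < b := by linarith
  obtain ⟨C1, hC1, H1⟩ : ∃ C1 : ℝ, 0 < C1 ∧ ∀ x, ‖x‖ ^ b ≤ C1 * max ‖gradient φ x‖ (Real.sqrt D) ^ a := by
    refine ⟨3 ^ b * ((CW / cW) ^ D * (CV / cV) ^ d * (Ipol n D / Ipol n d)
      * d ^ d * D ^ (-D) * 101 ^ D * 3 ^ (-(n:ℝ))), by positivity, fun x => ?_⟩
    by_cases hx : x = 0
    · rw [hx, norm_zero, Real.zero_rpow hb0.ne']; positivity
    · have := h.rev x hx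
      rw [← ha, ← hb, Real.div_rpow (by positivity) (by norm_num), div_le_iff₀ (by positivity)] at this
      linarith
  obtain ⟨C2, hC2, H2⟩ : ∃ C2 : ℝ, 0 < C2 ∧ ∀ x, ‖gradient φ x‖ ^ a ≤ C2 * max ‖x‖ (Real.sqrt d) ^ b := by
    refine ⟨3 ^ a * ((CV / cV) ^ d * (CW / cW) ^ D * (Ipol n d / Ipol n D)
      * D ^ D * d ^ (-d) * 101 ^ d * 3 ^ (-(n:ℝ))), by positivity, fun x => ?_⟩
    by_cases hx : gradient φ x = 0
    · rw [hx, norm_zero, Real.zero_rpow ha0.ne']; positivity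
    · have := h.fwd x hx
      rw [← ha, ← hb, Real.div_rpow (by positivity) (by norm_num), div_le_iff₀ (by positivity)] at this
      linarith
  have hsD : 0 < Real.sqrt D := Real.sqrt_pos.2 hD
  have hsd : 0 < Real.sqrt d := Real.sqrt_pos.2 hd
  have hmaxp : ∀ r, 0 < max r (Real.sqrt D) := fun r => lt_of_lt_of_le hsD (le_max_right _ _)
  set Z : ℝ → ℝ := fun r => (C1 * max r (Real.sqrt D) ^ a) ^ (1 / b) with hZ
  have hZ0 : ∀ r, 0 ≤ Z r := fun r => by
    have := hmaxp r
    simp only [hZ]; positivity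
  have hZc : Continuous Z := by
    apply Continuous.rpow_const _ (fun r => Or.inr (by positivity))
    apply continuous_const.mul
    exact Continuous.rpow_const (by fun_prop) (fun r => Or.inl (hmaxp r).ne')
  have hz : ∀ z, ‖z‖ ≤ Z ‖gradient φ z‖ := by
    intro z
    have := Real.rpow_le_rpow (by positivity) (H1 z) (show 0 ≤ 1 / b by positivity)
    rwa [← Real.rpow_mul (norm_nonneg _), mul_one_div_cancel hb0.ne', Real.rpow_one] at this
  have L0 : ∀ x w : Euc n, φ 0 + ⟪w, x⟫ - (‖gradient φ 0‖ + ‖w‖) * Z ‖w‖ ≤ φ x := by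
    apply conj_lower h.reg h.conv h.dense Z hZc hz (φ 0) _ (norm_nonneg _)
    intro z
    have h1 := grad_ineq h.reg h.conv 0 z
    rw [sub_zero] at h1
    have := (abs_le.1 (abs_real_inner_le_norm (gradient φ 0) z)).1
    linarith
  obtain ⟨m, hm⟩ : ∃ m, m = φ 0 - ‖gradient φ 0‖ * Z 0 := ⟨_, rfl⟩
  have hmin : ∀ x, m ≤ φ x := by
    intro x
    have := L0 x 0
    simp only [inner_zero_left, norm_zero, add_zero] at this
    linarith
  have L1 : ∀ x w : Euc n, m + ⟪w, x⟫ - (0 + ‖w‖) * Z ‖w‖ ≤ φ x :=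
    conj_lower h.reg h.conv h.dense Z hZc hz m 0 le_rfl (by simpa using hmin)
  have L2 : ∀ (x : Euc n) (t : ℝ), 0 ≤ t → m + t * ‖x‖ - t * Z t ≤ φ x := by
    intro x t ht
    by_cases hx : x = 0
    · have := hmin x
      have := mul_nonneg ht (hZ0 t)
      rw [hx, norm_zero] at *
      linarith
    · have hx0 : 0 < ‖x‖ := norm_pos_iff.2 hx
      have h1 := L1 x ((t / ‖x‖) • x)
      have e1 : ‖(t / ‖x‖) • x‖ = t := by
        rw [norm_smul, Real.norm_of_nonneg (by positivity)]; field_simp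
      rw [e1, real_inner_smul_left, real_inner_self_eq_norm_sq] at h1
      have e2 : t / ‖x‖ * ‖x‖ ^ 2 = t * ‖x‖ := by field_simp
      rw [e2] at h1; linarith
  -- choice of η
  obtain ⟨η, hη0, hη1⟩ : ∃ η : ℝ, 0 < η ∧ C1 * (η ^ a * C2) ≤ (1 / 2 : ℝ) ^ b := by
    refine ⟨((1 / 2 : ℝ) ^ b / (C1 * C2)) ^ (1 / a), by positivity, ?_⟩
    rw [← Real.rpow_mul (by positivity), one_div_mul_cancel ha0.ne', Real.rpow_one]
    apply le_of_eq; field_simp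
  refine ⟨m, 2 * K / η + K ^ 2 * d + D / η ^ 2, by positivity, hmin, ?_, ?_⟩
  · intro R hR
    refine ⟨R * Z R - m, fun x => ?_⟩
    have := L2 x R hR
    linarith
  · intro x
    have hm0 : 0 ≤ φ x - m := sub_nonneg.2 (hmin x)
    have hy0 := norm_nonneg (gradient φ x)
    have hK2 : 0 ≤ K ^ 2 * d := by positivity
    have hD2 : 0 ≤ D / η ^ 2 := by positivity
    have hKη : 0 ≤ 2 * K / η := by positivity
    by_cases hx : ‖x‖ < Real.sqrt d
    · have h1 := hK x
      rw [max_eq_right hx.le] at h1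
      have h2 : ‖gradient φ x‖ ^ 2 ≤ K ^ 2 * d := by
        calc _ ≤ (K * Real.sqrt d) ^ 2 := by gcongr
          _ = _ := by rw [mul_pow, Real.sq_sqrt hd.le]
      nlinarith
    · push Not at hx
      have hx0 : 0 < ‖x‖ := hsd.trans_le hx
      by_cases hy : η * ‖gradient φ x‖ < Real.sqrt D
      · have h2 : ‖gradient φ x‖ ^ 2 ≤ D / η ^ 2 := by
          rw [le_div_iff₀ (by positivity)]
          have : (η * ‖gradient φ x‖) ^ 2 ≤ D := by
            rw [← Real.sq_sqrt hD.le]; gcongr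
          linarith [mul_pow η ‖gradient φ x‖ 2]
        nlinarith
      · push Not at hy
        have h1 := hK x
        have h2 := H2 x
        rw [max_eq_left hx] at h1 h2
        have h3 : Z (η * ‖gradient φ x‖) ≤ ‖x‖ / 2 := by
          simp only [hZ]
          rw [max_eq_left hy]
          have h4 : C1 * (η * ‖gradient φ x‖) ^ a ≤ (‖x‖ / 2) ^ b := by
            rw [Real.mul_rpow hη0.le hy0]
            calc C1 * (η ^ a * ‖gradient φ x‖ ^ a) ≤ C1 * (η ^ a * (C2 * ‖x‖ ^ b)) := by gcongr
              _ = C1 * (η ^ a * C2) * ‖x‖ ^ b := by ring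
              _ ≤ (1 / 2 : ℝ) ^ b * ‖x‖ ^ b := by gcongr
              _ = _ := by rw [← Real.mul_rpow (by norm_num) hx0.le]; congr 1; ring
          have h5 := Real.rpow_le_rpow (by positivity) h4 (show 0 ≤ 1 / b by positivity)
          rwa [← Real.rpow_mul (by positivity), mul_one_div_cancel hb0.ne', Real.rpow_one] at h5
        have h6 := L2 x (η * ‖gradient φ x‖) (by positivity)
        have h7 : η * ‖gradient φ x‖ * Z (η * ‖gradient φ x‖) ≤ η * ‖gradient φ x‖ * (‖x‖ / 2) := by
          gcongr
        have h8 : η / 2 * (‖gradient φ x‖ * ‖x‖) ≤ φ x - m := by linarith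
        have h9 : ‖gradient φ x‖ ^ 2 ≤ 2 * K / η * (φ x - m) := by
          calc ‖gradient φ x‖ ^ 2 ≤ ‖gradient φ x‖ * (K * ‖x‖) := by rw [sq]; gcongr
            _ = 2 * K / η * (η / 2 * (‖gradient φ x‖ * ‖x‖)) := by field_simp
            _ ≤ _ := by gcongr
        nlinarith

end Growth2

section Maxi
variable {n : ℕ}

/-- The perturbed second difference. -/
def Phi (φ : Euc n → ℝ) (T h : ℝ) (x e : Euc n) : ℝ :=
  φ (x + h • e) + φ (x - h • e) - 2 * T * φ x

lemma Phi_max_exists {φ : Euc n → ℝ} (hn : 1 ≤ n) (hφ : ContDiff ℝ 2 φ) (hc : ConvexOn ℝ univ φ)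
    (K s : ℝ) (hK0 : 0 ≤ K) (hs : 0 ≤ s) (hK : ∀ x, ‖gradient φ x‖ ≤ K * max ‖x‖ s)
    (hsup : ∀ R : ℝ, 0 ≤ R → ∃ C, ∀ x, R * ‖x‖ - C ≤ φ x) (h δ : ℝ) (hh : 0 < h) (hδ : 0 < δ) :
    ∃ x e, ‖e‖ = 1 ∧ ∀ x' e', ‖e'‖ = 1 → Phi φ (1 + δ) h x' e' ≤ Phi φ (1 + δ) h x e := by
  have : Nonempty (Fin n) := ⟨⟨0, hn⟩⟩
  obtain ⟨e0, he0⟩ := exists_norm_eq (Euc n) (zero_le_one' ℝ)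
  obtain ⟨C, hC⟩ := hsup ((h * K + 1) / δ) (by positivity)
  have hφc : Continuous φ := hφ.continuous
  have bound : ∀ x e, ‖e‖ = 1 → Phi φ (1 + δ) h x e ≤ 2 * h * K * (h + s) + 2 * δ * C - 2 * ‖x‖ := by
    intro x e he
    have hhe : ‖h • e‖ = h := by rw [norm_smul, he, Real.norm_of_nonneg hh.le, mul_one]
    have g1 := grad_ineq hφ hc (x + h • e) x
    have g2 := grad_ineq hφ hc (x - h • e) x
    have i1 := (abs_le.1 (abs_real_inner_le_norm (gradient φ (x + h • e)) (x - (x + h • e)))).1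
    have i2 := (abs_le.1 (abs_real_inner_le_norm (gradient φ (x - h • e)) (x - (x - h • e)))).1
    have n1 : ‖x - (x + h • e)‖ = h := by
      rw [sub_add_cancel_left, norm_neg, hhe]
    have n2 : ‖x - (x - h • e)‖ = h := by
      rw [sub_sub_cancel, hhe]
    rw [n1] at i1; rw [n2] at i2
    have b1 : ‖gradient φ (x + h • e)‖ ≤ K * (‖x‖ + h + s) := by
      refine (hK _).trans ?_
      gcongr
      apply max_le
      · have := norm_add_le x (h • e); linarith
      · have := norm_nonneg x; linarith
    have b2 : ‖gradient φ (x - h • e)‖ ≤ K * (‖x‖ + h + s) := by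
      refine (hK _).trans ?_
      gcongr
      apply max_le
      · have := norm_sub_le x (h • e); linarith
      · have := norm_nonneg x; linarith
    have c1 := mul_le_mul_of_nonneg_right b1 hh.le
    have c2 := mul_le_mul_of_nonneg_right b2 hh.le
    have c3 := mul_le_mul_of_nonneg_left (hC x) hδ.le
    have c4 : δ * ((h * K + 1) / δ * ‖x‖ - C) = (h * K + 1) * ‖x‖ - δ * C := by field_simp
    rw [c4] at c3
    unfold Phi
    linarith
  set B0 := 2 * h * K * (h + s) + 2 * δ * C with hB0
  set ρ := max 0 (B0 - Phi φ (1 + δ) h 0 e0) with hρ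
  have hS : IsCompact (closedBall (0 : Euc n) ρ ×ˢ sphere (0 : Euc n) 1) :=
    (isCompact_closedBall _ _).prod (isCompact_sphere _ _)
  have hcont : Continuous (fun q : Euc n × Euc n => Phi φ (1 + δ) h q.1 q.2) := by
    unfold Phi; fun_prop
  obtain ⟨⟨x, e⟩, hm, hmax⟩ := hS.exists_isMaxOn ⟨(0, e0), by simp [hρ, he0]⟩ hcont.continuousOn
  have he : ‖e‖ = 1 := by simpa using hm.2
  refine ⟨x, e, he, fun x' e' he' => ?_⟩
  by_cases hx : ‖x'‖ ≤ ρ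
  · exact hmax (show (x', e') ∈ _ from ⟨by simpa using hx, by simpa using he'⟩)
  · push Not at hx
    have h0 : Phi φ (1 + δ) h 0 e0 ≤ Phi φ (1 + δ) h x e :=
      hmax (show ((0 : Euc n), e0) ∈ _ from ⟨by simp [hρ], by simpa using he0⟩)
    have h1 := bound x' e' he'
    have h2 : B0 - Phi φ (1 + δ) h 0 e0 ≤ ρ := le_max_right _ _
    have h3 : 0 ≤ ρ := le_max_left _ _
    linarith

/-- First and second order conditions at a maximum point. -/
lemma Phi_max_cond {φ : Euc n → ℝ} (hφ : ContDiff ℝ 2 φ) (hc : ConvexOn ℝ univ φ)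
    (h T : ℝ) (hh : 0 < h) (x e : Euc n) (he : ‖e‖ = 1)
    (hmax : ∀ x' e', ‖e'‖ = 1 → Phi φ T h x' e' ≤ Phi φ T h x e) :
    (∃ κ : ℝ, 0 ≤ κ ∧ gradient φ (x + h • e) = T • gradient φ x + (h * κ) • e ∧
      gradient φ (x - h • e) = T • gradient φ x - (h * κ) • e) ∧
    ∀ v, hess φ (x + h • e) v + hess φ (x - h • e) v ≤ 2 * T * hess φ x v := by
  constructor
  · have ha : gradient φ (x + h • e) + gradient φ (x - h • e) = (2 * T) • gradient φ x := by
      rw [← sub_eq_zero]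
      refine ext_inner_right ℝ (fun v => ?_)
      rw [inner_zero_left]
      have d1 := hasDerivAt_line hφ (x + h • e) v 0
      have d2 := hasDerivAt_line hφ (x - h • e) v 0
      have d3 := hasDerivAt_line hφ x v 0
      have dd := (d1.add d2).sub (d3.const_mul (2 * T))
      simp only [zero_smul, add_zero] at dd
      rw [inner_sub_left, inner_add_left, real_inner_smul_left]
      refine IsLocalMax.hasDerivAt_eq_zero ?_ dd
      refine Filter.Eventually.of_forall (fun t => ?_)
      have := hmax (x + t • v) e he
      unfold Phi at this
      simp only [Pi.add_apply, Pi.sub_apply, zero_smul, add_zero]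
      rw [show x + h • e + t • v = x + t • v + h • e by abel,
        show x - h • e + t • v = x + t • v - h • e by abel]
      exact this
    set p := gradient φ (x + h • e) - gradient φ (x - h • e) with hp
    have hin : ∀ e', ‖e'‖ = 1 → ⟪p, e'⟫ ≤ ⟪p, e⟫ := by
      intro e' he'
      have h1 := grad_ineq hφ hc (x + h • e) (x + h • e')
      have h2 := grad_ineq hφ hc (x - h • e) (x - h • e')
      have h3 := hmax x e' he'
      unfold Phi at h3
      have e1 : x + h • e' - (x + h • e) = h • (e' - e) := by rw [smul_sub]; abel
      have e2 : x - h • e' - (x - h • e) = -(h • (e' - e)) := by rw [smul_sub]; abel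
      rw [e1, inner_smul_right] at h1
      rw [e2, inner_neg_right, inner_smul_right] at h2
      have h4 : h * ⟪p, e' - e⟫ ≤ 0 := by
        rw [hp, inner_sub_left]; linarith
      have h5 : ⟪p, e' - e⟫ ≤ 0 := by
        by_contra hcon
        push Not at hcon
        have := mul_pos hh hcon
        linarith
      rw [inner_sub_right] at h5
      linarith
    have hpe : p = ‖p‖ • e := by
      by_cases hp0 : p = 0
      · rw [hp0]; simp
      have hpn : 0 < ‖p‖ := norm_pos_iff.2 hp0
      have h1 := hin (‖p‖⁻¹ • p) (by rw [norm_smul, norm_inv, norm_norm, inv_mul_cancel₀ hpn.ne'])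
      rw [inner_smul_right, real_inner_self_eq_norm_sq] at h1
      have e1 : ‖p‖⁻¹ * ‖p‖ ^ 2 = ‖p‖ := by field_simp
      rw [e1] at h1
      rw [← sub_eq_zero, ← norm_eq_zero, ← sq_eq_zero_iff]
      apply le_antisymm _ (sq_nonneg _)
      rw [norm_sub_sq_real, inner_smul_right, norm_smul, norm_norm, he]
      nlinarith
    refine ⟨‖p‖ / (2 * h), by positivity, ?_, ?_⟩
    · have : (h * (‖p‖ / (2 * h))) • e = (1 / 2 : ℝ) • p := by
        rw [show h * (‖p‖ / (2 * h)) = (1 / 2) * ‖p‖ by field_simp, mul_smul, ← hpe]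
      rw [this]
      have h2 : T • gradient φ x = (1 / 2 : ℝ) • (gradient φ (x + h • e) + gradient φ (x - h • e)) := by
        rw [ha, smul_smul]; congr 1; ring
      rw [h2, hp]; module
    · have : (h * (‖p‖ / (2 * h))) • e = (1 / 2 : ℝ) • p := by
        rw [show h * (‖p‖ / (2 * h)) = (1 / 2) * ‖p‖ by field_simp, mul_smul, ← hpe]
      rw [this]
      have h2 : T • gradient φ x = (1 / 2 : ℝ) • (gradient φ (x + h • e) + gradient φ (x - h • e)) := by
        rw [ha, smul_smul]; congr 1; ring
      rw [h2, hp]; module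
  · intro v
    have t1 := tendsto_secdiff hφ (x + h • e) v
    have t2 := tendsto_secdiff hφ (x - h • e) v
    have t3 := (tendsto_secdiff hφ x v).const_mul (2 * T)
    refine le_of_tendsto_of_tendsto (t1.add t2) t3 (Filter.Eventually.of_forall (fun t => ?_))
    have m1 := hmax (x + t • v) e he
    have m2 := hmax (x - t • v) e he
    unfold Phi at m1 m2
    simp only
    rw [← add_div, ← mul_div_assoc]
    apply div_le_div_of_nonneg_right _ (sq_nonneg t)
    rw [show x + h • e + t • v = x + t • v + h • e by abel,
        show x - h • e + t • v = x + t • v - h • e by abel,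
        show x + h • e - t • v = x - t • v + h • e by abel,
        show x - h • e - t • v = x - t • v - h • e by abel]
    linarith

variable {V W φ : Euc n → ℝ} {d D cV CV cW CW : ℝ}

lemma rho_pow {U : Euc n → ℝ} {p c C : ℝ} (hq : QB U p c C) (x : Euc n) :
    rho U p x = (Znorm U p)⁻¹ * ((p + U x) ^ p)⁻¹ * p ^ p := by
  have hp := hq.p0
  have e : 1 + U x / p = (p + U x) / p := by field_simp
  have h0 : 0 < p + U x := by
    have := hq.pos' x
    rw [e] at this
    exact (div_pos_iff_of_pos_right hp).1 this
  unfold rho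
  rw [e, Real.rpow_neg (by positivity), Real.div_rpow h0.le hp.le, inv_div]
  field_simp

lemma QB.fpos {U : Euc n → ℝ} {p c C : ℝ} (hq : QB U p c C) (x : Euc n) : 0 < p + U x := by
  have hp := hq.p0
  have := hq.lo x
  have : 0 < c * (p + ‖x‖ ^ 2) := mul_pos hq.c0p (by positivity)
  linarith

lemma Setup.det_eq (h : Setup V W φ d D cV CV cW CW) (x : Euc n) :
    (fderiv ℝ (gradient φ) x).det =
      (Znorm W D / Znorm V d * d ^ d / D ^ D) * ((D + W (gradient φ x)) ^ D / (d + V x) ^ d) := by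
  have h1 := h.ma x
  rw [rho_pow h.qV, rho_pow h.qW] at h1
  have p1 := Real.rpow_pos_of_pos (h.qV.fpos x) d
  have p2 := Real.rpow_pos_of_pos (h.qW.fpos (gradient φ x)) D
  have p3 := h.qV.Z_pos
  have p4 := h.qW.Z_pos
  have p5 := Real.rpow_pos_of_pos h.qV.p0 d
  have p6 := Real.rpow_pos_of_pos h.qW.p0 D
  field_simp at h1 ⊢
  linarith

lemma Setup.det_pos (h : Setup V W φ d D cV CV cW CW) (x : Euc n) :
    0 < (fderiv ℝ (gradient φ) x).det := by
  rw [h.det_eq]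
  have p1 := Real.rpow_pos_of_pos (h.qV.fpos x) d
  have p2 := Real.rpow_pos_of_pos (h.qW.fpos (gradient φ x)) D
  have p3 := h.qV.Z_pos
  have p4 := h.qW.Z_pos
  have p5 := Real.rpow_pos_of_pos h.qV.p0 d
  have p6 := Real.rpow_pos_of_pos h.qW.p0 D
  positivity

lemma rpow_sum_le (u v s T : ℝ) (hu : 0 ≤ u) (hv : 0 ≤ v) (hs : 0 < s) (hs1 : s ≤ 1) (hT : 1 ≤ T)
    (h : u + v ≤ 2 * T) : u ^ s + v ^ s ≤ 2 * T := by
  have hc := (Real.concaveOn_rpow hs.le hs1).2 (x := u) (y := v) hu hv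
    (show (0:ℝ) ≤ 1/2 by norm_num) (show (0:ℝ) ≤ 1/2 by norm_num) (by norm_num)
  simp only [smul_eq_mul] at hc
  have h1 : (1 / 2 * u + 1 / 2 * v) ^ s ≤ T ^ s :=
    Real.rpow_le_rpow (by positivity) (by linarith) hs.le
  have h2 : T ^ s ≤ T := by
    have := Real.rpow_le_rpow_of_exponent_le hT hs1
    rwa [Real.rpow_one] at this
  linarith

/-- The key scalar inequality coming from the Monge–Ampère equation. -/
lemma Setup.scalar (h : Setup V W φ d D cV CV cW CW) (T : ℝ) (hT : 1 ≤ T) (x xp xm : Euc n)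
    (hess_le : ∀ v, hess φ xp v + hess φ xm v ≤ 2 * T * hess φ x v) :
    ((D + W (gradient φ xp)) / (D + W (gradient φ x))) ^ (D / d) / ((d + V xp) / (d + V x))
    + ((D + W (gradient φ xm)) / (D + W (gradient φ x))) ^ (D / d) / ((d + V xm) / (d + V x))
      ≤ 2 * T := by
  have hd := h.qV.p0
  have hn1 : (1:ℝ) ≤ n := by exact_mod_cast h.hn
  have hdn := h.qV.pn
  have sy := fun z => fderiv_gradient_symm h.reg z
  have po := fun z => fderiv_grad_pos h.reg h.conv z
  have h1 := op_mink h.hn (sy xp) (po xp) (sy xm) (po xm) (sy x) (po x) (h.det_pos x) (2 * T) (by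
    intro v
    have := hess_le v
    rwa [hess_eq_inner h.reg, hess_eq_inner h.reg, hess_eq_inner h.reg] at this)
  set a := (fderiv ℝ (gradient φ) xp).det with ha
  set b := (fderiv ℝ (gradient φ) xm).det with hb
  set c := (fderiv ℝ (gradient φ) x).det with hc
  have ha0 : 0 < a := h.det_pos xp
  have hb0 : 0 < b := h.det_pos xm
  have hc0 : 0 < c := h.det_pos x
  have hcn := Real.rpow_pos_of_pos hc0 (1 / (n:ℝ))
  have h2 : (a / c) ^ (1 / (n:ℝ)) + (b / c) ^ (1 / (n:ℝ)) ≤ 2 * T := by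
    rw [Real.div_rpow ha0.le hc0.le, Real.div_rpow hb0.le hc0.le, ← add_div, div_le_iff₀ hcn]
    exact h1
  have h3 := rpow_sum_le _ _ ((n:ℝ) / d) T (by positivity) (by positivity) (by positivity)
    ((div_le_one hd).2 hdn) hT h2
  rw [← Real.rpow_mul (by positivity), ← Real.rpow_mul (by positivity)] at h3
  have e0 : 1 / (n:ℝ) * ((n:ℝ) / d) = 1 / d := by field_simp
  rw [e0] at h3
  have key : ∀ z, ((fderiv ℝ (gradient φ) z).det / c) ^ (1 / d) =
      ((D + W (gradient φ z)) / (D + W (gradient φ x))) ^ (D / d) / ((d + V z) / (d + V x)) := by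
    intro z
    have q1 := h.qV.fpos x
    have q2 := h.qW.fpos (gradient φ x)
    have q3 := h.qV.fpos z
    have q4 := h.qW.fpos (gradient φ z)
    have p3 := h.qV.Z_pos
    have p4 := h.qW.Z_pos
    have p5 := Real.rpow_pos_of_pos h.qV.p0 d
    have p6 := Real.rpow_pos_of_pos h.qW.p0 D
    have e1 : (fderiv ℝ (gradient φ) z).det / c =
        ((D + W (gradient φ z)) / (D + W (gradient φ x))) ^ D / ((d + V z) / (d + V x)) ^ d := by
      rw [hc, h.det_eq z, h.det_eq x, Real.div_rpow q4.le q2.le, Real.div_rpow q3.le q1.le]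
      have r1 := Real.rpow_pos_of_pos q1 d
      have r2 := Real.rpow_pos_of_pos q2 D
      have r3 := Real.rpow_pos_of_pos q3 d
      have r4 := Real.rpow_pos_of_pos q4 D
      field_simp
    rw [e1, Real.div_rpow (by positivity) (by positivity), ← Real.rpow_mul (by positivity),
      ← Real.rpow_mul (by positivity), mul_one_div_cancel hd.ne', Real.rpow_one, mul_one_div]
  rw [key xp, key xm] at h3
  exact h3

end Maxi

section RealIneq

lemma bern (α P : ℝ) (hα : 1 ≤ α) (hP : 0 ≤ P) : 1 + α * (P - 1) ≤ P ^ α := by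
  have := one_add_mul_self_le_rpow_one_add (s := P - 1) (by linarith) hα
  simpa using this

lemma opt1_aux (α δ a b q r C s1 s2 : ℝ) (hα : 1 ≤ α) (hδ : 0 ≤ δ) (hq : 0 ≤ q) (ha : 0 ≤ a)
    (hC : 0 ≤ C) (hr : -(C * δ) ≤ r) (hs2 : 0 ≤ s2)
    (hs : s1 + s2 ≤ 2 * (1 + δ))
    (h1 : 1 + α * (b + r) ≤ s1 * (1 + a + q)) (h2 : 1 + α * (-b + r) ≤ s2 * (1 - a + q)) :
    α * r ≤ δ + (1 + δ) * q + a * (δ + q + α * |b| + α * C * δ) := by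
  set X := 1 - α * |b| - α * C * δ with hX
  have hb : b ≤ |b| := le_abs_self b
  have hX1 : X ≤ 1 := by
    have : 0 ≤ α * |b| := by positivity
    have : 0 ≤ α * C * δ := by positivity
    linarith
  have k1 : X ≤ s2 * (1 + q) := by
    have e1 : α * b ≤ α * |b| := by gcongr
    have e2 : α * (-(C * δ)) ≤ α * r := by gcongr
    have e3 : 0 ≤ s2 * a := by positivity
    nlinarith
  have k2 : X - q ≤ s2 := by
    by_contra hcon
    push Not at hcon
    nlinarith [mul_nonneg hq hs2]
  have k3 : s1 - s2 ≤ 2 * (δ + q + α * |b| + α * C * δ) := by linarith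
  have k4 : a * (s1 - s2) ≤ a * (2 * (δ + q + α * |b| + α * C * δ)) := by gcongr
  have k5 : (s1 + s2) * (1 + q) ≤ 2 * (1 + δ) * (1 + q) := by gcongr
  nlinarith

lemma opt1 (α δ a b q r C P1 P2 Q1 Q2 : ℝ) (hα : 1 ≤ α) (hδ : 0 ≤ δ) (hq : 0 ≤ q)
    (hC : 0 ≤ C) (hr : -(C * δ) ≤ r)
    (hP1 : 0 < P1) (hP2 : 0 < P2) (hQ1 : 0 < Q1) (hQ2 : 0 < Q2)
    (hs : P1 ^ α / Q1 + P2 ^ α / Q2 ≤ 2 * (1 + δ))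
    (q1 : Q1 ≤ 1 + a + q) (q2 : Q2 ≤ 1 - a + q) (p1 : 1 + b + r ≤ P1) (p2 : 1 - b + r ≤ P2) :
    α * r ≤ δ + (1 + δ) * q + |a| * (δ + q + α * |b| + α * C * δ) := by
  have s1 : 0 ≤ P1 ^ α / Q1 := by positivity
  have s2 : 0 ≤ P2 ^ α / Q2 := by positivity
  have t1 : 1 + α * (b + r) ≤ P1 ^ α / Q1 * (1 + a + q) := by
    have := bern α P1 hα hP1.le
    have h2 : α * (b + r) ≤ α * (P1 - 1) := by gcongr; linarith
    have h3 : P1 ^ α / Q1 * Q1 ≤ P1 ^ α / Q1 * (1 + a + q) := by gcongr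
    rw [div_mul_cancel₀ _ hQ1.ne'] at h3
    linarith
  have t2 : 1 + α * (-b + r) ≤ P2 ^ α / Q2 * (1 - a + q) := by
    have := bern α P2 hα hP2.le
    have h2 : α * (-b + r) ≤ α * (P2 - 1) := by gcongr; linarith
    have h3 : P2 ^ α / Q2 * Q2 ≤ P2 ^ α / Q2 * (1 - a + q) := by gcongr
    rw [div_mul_cancel₀ _ hQ2.ne'] at h3
    linarith
  rcases le_total 0 a with ha | ha
  · rw [abs_of_nonneg ha]
    exact opt1_aux α δ a b q r C _ _ hα hδ hq ha hC hr s2 hs t1 t2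
  · rw [abs_of_nonpos ha, ← abs_neg b]
    apply opt1_aux α δ (-a) (-b) q r C (P2 ^ α / Q2) (P1 ^ α / Q1) hα hδ hq (by linarith) hC hr s1
      (by linarith)
    · rw [← sub_eq_add_neg]; exact t2
    · rw [neg_neg, sub_neg_eq_add]; exact t1

lemma pow_quad (Γ t : ℝ) (hΓ : 0 ≤ Γ) (ht : 0 < 1 + t) (h : 2 * (Γ * t) ≤ 1) :
    (1 + t) ^ (1 + Γ) ≤ 1 + (1 + Γ) * t + 2 * (1 + Γ) * Γ * t ^ 2 := by
  have h1 : 1 - Γ * t ≤ (1 + t) ^ (-Γ) := by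
    rw [Real.rpow_def_of_pos ht]
    have l1 := Real.log_le_sub_one_of_pos ht
    have l2 := Real.add_one_le_exp (Real.log (1 + t) * -Γ)
    nlinarith
  have h0 : 0 < 1 - Γ * t := by linarith
  have h2 : (1 + t) ^ (1 + Γ) ≤ (1 + t) / (1 - Γ * t) := by
    rw [Real.rpow_add ht, Real.rpow_one, div_eq_mul_inv]
    apply mul_le_mul_of_nonneg_left _ ht.le
    rw [Real.rpow_neg ht.le] at h1
    have hp := Real.rpow_pos_of_pos ht Γ
    rw [le_inv_comm₀ hp h0]; exact h1
  refine h2.trans ?_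
  rw [div_le_iff₀ h0]
  have : 0 ≤ (1 + Γ) * Γ * t ^ 2 * (1 - 2 * (Γ * t)) := by
    have : 0 ≤ 1 - 2 * (Γ * t) := by linarith
    positivity
  nlinarith

lemma opt2 (α δ Γ a b q r P1 P2 Q1 Q2 : ℝ) (hα : 1 < α) (hδ : 0 ≤ δ) (hq : 0 ≤ q)
    (hΓ : 0 ≤ Γ) (hαΓ : 1 ≤ (α - 1) * (1 + Γ))
    (hP1 : 0 < P1) (hP2 : 0 < P2) (hQ1 : 0 < Q1) (hQ2 : 0 < Q2)
    (hs : P1 ^ α / Q1 + P2 ^ α / Q2 ≤ 2 * (1 + δ))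
    (q1 : Q1 ≤ 1 + a + q) (q2 : Q2 ≤ 1 - a + q) (p1 : 1 + b + r ≤ P1) (p2 : 1 - b + r ≤ P2)
    (hsm : 2 * (Γ * (|a| + q)) ≤ 1) :
    α * r ≤ δ + (1 + δ) * (q + 2 * Γ * (a ^ 2 + q ^ 2)) := by
  set γ := 1 + Γ with hγ
  have hγ1 : 1 ≤ γ := by linarith
  have hγ0 : 0 < γ := by linarith
  have hα0 : 0 < α := by linarith
  set T := 1 + δ with hT
  have hT0 : 0 < T := by linarith
  set X := q + 2 * Γ * (a ^ 2 + q ^ 2) with hX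
  have hX0 : 0 ≤ X := by positivity
  set M := 1 + γ * X with hM
  have hM0 : 0 < M := by positivity
  have g1 : Q1 ^ γ ≤ 1 + γ * (a + q) + 2 * γ * Γ * (a + q) ^ 2 := by
    refine le_trans (Real.rpow_le_rpow hQ1.le (by linarith : Q1 ≤ 1 + (a + q)) hγ0.le) ?_
    apply pow_quad Γ (a + q) hΓ (by linarith)
    have : Γ * (a + q) ≤ Γ * (|a| + q) := by gcongr; exact le_abs_self a
    linarith
  have g2 : Q2 ^ γ ≤ 1 + γ * (-a + q) + 2 * γ * Γ * (-a + q) ^ 2 := by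
    refine le_trans (Real.rpow_le_rpow hQ2.le (by linarith : Q2 ≤ 1 + (-a + q)) hγ0.le) ?_
    apply pow_quad Γ (-a + q) hΓ (by linarith)
    have : Γ * (-a + q) ≤ Γ * (|a| + q) := by gcongr; exact neg_le_abs a
    linarith
  have gM : Q1 ^ γ + Q2 ^ γ ≤ 2 * M := by
    have : 2 * M = (1 + γ * (a + q) + 2 * γ * Γ * (a + q) ^ 2)
      + (1 + γ * (-a + q) + 2 * γ * Γ * (-a + q) ^ 2) := by rw [hM, hX]; ring
    linarith
  have hw3 : 0 ≤ 1 - 1 / α - 1 / (α * γ) := by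
    have : 1 - 1 / α - 1 / (α * γ) = ((α - 1) * γ - 1) / (α * γ) := by field_simp
    rw [this]; apply div_nonneg <;> nlinarith
  have amgm : ∀ P Q : ℝ, 0 < P → 0 < Q → P / (T ^ (1 / α) * M ^ (1 / (α * γ))) ≤
      1 / α * ((P ^ α / Q) / T) + 1 / (α * γ) * (Q ^ γ / M) + (1 - 1 / α - 1 / (α * γ)) * 1 := by
    intro P Q hP hQ
    have := Real.geom_mean_le_arith_mean3_weighted (w₁ := 1 / α) (w₂ := 1 / (α * γ))
      (w₃ := 1 - 1 / α - 1 / (α * γ)) (p₁ := (P ^ α / Q) / T) (p₂ := Q ^ γ / M) (p₃ := 1)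
      (by positivity) (by positivity) hw3 (by positivity) (by positivity) (by norm_num) (by ring)
    refine le_trans (le_of_eq ?_) this
    rw [Real.one_rpow, mul_one, Real.div_rpow (by positivity) hT0.le, Real.div_rpow (by positivity) hQ.le,
      Real.div_rpow (by positivity) hM0.le, ← Real.rpow_mul hP.le, ← Real.rpow_mul hQ.le,
      mul_one_div_cancel hα0.ne', Real.rpow_one]
    have e : γ * (1 / (α * γ)) = 1 / α := by field_simp
    rw [e]
    have := Real.rpow_pos_of_pos hQ (1 / α)
    field_simp
  have m1 := amgm P1 Q1 hP1 hQ1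
  have m2 := amgm P2 Q2 hP2 hQ2
  set L := T ^ (1 / α) * M ^ (1 / (α * γ)) with hL
  have hL0 : 0 < L := by positivity
  have m3 : (P1 + P2) / L ≤ 2 := by
    have e1 : (P1 ^ α / Q1) / T + (P2 ^ α / Q2) / T ≤ 2 := by
      rw [← add_div, div_le_iff₀ hT0]; linarith
    have e2 : Q1 ^ γ / M + Q2 ^ γ / M ≤ 2 := by
      rw [← add_div, div_le_iff₀ hM0]; linarith
    have e3 : 1 / α * ((P1 ^ α / Q1) / T + (P2 ^ α / Q2) / T) ≤ 1 / α * 2 := by gcongr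
    have e4 : 1 / (α * γ) * (Q1 ^ γ / M + Q2 ^ γ / M) ≤ 1 / (α * γ) * 2 := by gcongr
    rw [add_div]
    linarith
  rw [div_le_iff₀ hL0] at m3
  have m4 : ((P1 + P2) / 2) ^ α ≤ T * M ^ (1 / γ) := by
    have := Real.rpow_le_rpow (by positivity) (by linarith : (P1 + P2) / 2 ≤ L) hα0.le
    refine this.trans (le_of_eq ?_)
    rw [hL, Real.mul_rpow (by positivity) (by positivity), ← Real.rpow_mul hT0.le,
      ← Real.rpow_mul hM0.le, one_div_mul_cancel hα0.ne', Real.rpow_one]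
    congr 2; field_simp
  have m5 : M ^ (1 / γ) ≤ 1 + X := by
    have := rpow_one_add_le_one_add_mul_self (s := γ * X) (p := 1 / γ) (by nlinarith) (by positivity)
      (by rw [div_le_one hγ0]; exact hγ1)
    refine this.trans (le_of_eq ?_)
    field_simp
  have m6 := bern α ((P1 + P2) / 2) hα.le (by positivity)
  have m7 : α * r ≤ α * ((P1 + P2) / 2 - 1) := by gcongr; linarith
  have m8 : T * M ^ (1 / γ) ≤ T * (1 + X) := by gcongr
  have : T * (1 + X) = 1 + δ + T * X := by rw [hT]; ring
  linarith

end RealIneq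

section AtMax
variable {n : ℕ}

/-- Further assumptions: derivative bounds. -/
structure Setup2 (V W φ : Euc n → ℝ) (d D cV CV cW CW CV2 cW2 C1V C1W β : ℝ) : Prop extends
    Setup V W φ d D cV CV cW CW where
  hdD : d ≤ D
  regV : ContDiff ℝ 2 V
  regW : ContDiff ℝ 2 W
  hCV2 : 0 < CV2
  hcW2 : 0 < cW2
  hessV : ∀ x v, hess V x v ≤ CV2 * ‖v‖ ^ 2
  hessW : ∀ y v, cW2 * ‖v‖ ^ 2 ≤ hess W y v
  hC1V : 0 ≤ C1V
  hC1W : 0 ≤ C1W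
  gradV : ∀ x, ‖gradient V x‖ ^ 2 ≤ 2 * C1V * (d + ‖x‖ ^ 2)
  gradW : ∀ y, ‖gradient W y‖ ^ 2 ≤ 2 * C1W * (D + ‖y‖ ^ 2)
  hβ : 0 < β
  growth : ∀ x, D + ‖gradient φ x‖ ^ 2 ≤ β * (d + ‖x‖ ^ 2)

variable {V W φ : Euc n → ℝ} {d D cV CV cW CW CV2 cW2 C1V C1W β : ℝ}

lemma Setup2.normx (H : Setup2 V W φ d D cV CV cW CW CV2 cW2 C1V C1W β) (x : Euc n) :
    d + ‖x‖ ^ 2 ≤ (d + V x) / cV := by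
  rw [le_div_iff₀ H.qV.c0p, mul_comm]; exact H.qV.lo x

lemma Setup2.normy (H : Setup2 V W φ d D cV CV cW CW CV2 cW2 C1V C1W β) (x : Euc n) :
    D + ‖x‖ ^ 2 ≤ (D + W x) / cW := by
  rw [le_div_iff₀ H.qW.c0p, mul_comm]; exact H.qW.lo x

lemma Setup2.fge (H : Setup2 V W φ d D cV CV cW CW CV2 cW2 C1V C1W β) (x : Euc n) :
    cV * d ≤ d + V x := by
  refine le_trans ?_ (H.qV.lo x)
  have := H.qV.c0p
  gcongr
  have := sq_nonneg ‖x‖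
  linarith

lemma Setup2.gf (H : Setup2 V W φ d D cV CV cW CW CV2 cW2 C1V C1W β) (x : Euc n) :
    (D + W (gradient φ x)) ≤ CW * β / cV * (d + V x) := by
  have h1 := H.qW.up (gradient φ x)
  have h2 := H.growth x
  have h3 := H.normx x
  have := H.qW.C0p
  have := H.hβ
  calc _ ≤ CW * (β * ((d + V x) / cV)) := h1.trans (by gcongr; exact h2.trans (by gcongr))
    _ = _ := by ring

lemma inner_sq_le (u e : Euc n) (he : ‖e‖ = 1) : ⟪u, e⟫ ^ 2 ≤ ‖u‖ ^ 2 := by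
  have := abs_real_inner_le_norm u e
  rw [he, mul_one] at this
  rw [← sq_abs]; gcongr

lemma Setup2.Ve (H : Setup2 V W φ d D cV CV cW CW CV2 cW2 C1V C1W β) (x e : Euc n) (he : ‖e‖ = 1) :
    ⟪gradient V x, e⟫ ^ 2 ≤ 2 * C1V / cV * (d + V x) := by
  have := H.hC1V
  calc _ ≤ _ := inner_sq_le _ e he
    _ ≤ _ := H.gradV x
    _ ≤ 2 * C1V * ((d + V x) / cV) := by gcongr; exact H.normx x
    _ = _ := by ring

lemma Setup2.We (H : Setup2 V W φ d D cV CV cW CW CV2 cW2 C1V C1W β) (x e : Euc n) (he : ‖e‖ = 1) :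
    ⟪gradient W (gradient φ x), e⟫ ^ 2 ≤ 2 * C1W * β / cV * (d + V x) := by
  have := H.hC1W
  have := H.hβ
  calc _ ≤ _ := inner_sq_le _ e he
    _ ≤ _ := H.gradW _
    _ ≤ 2 * C1W * (β * ((d + V x) / cV)) := by
        gcongr; exact (H.growth x).trans (by gcongr; exact H.normx x)
    _ = _ := by ring

lemma Setup2.Vk (H : Setup2 V W φ d D cV CV cW CW CV2 cW2 C1V C1W β) (x e : Euc n) (he : ‖e‖ = 1) :
    |⟪gradient V x, e⟫| / (d + V x) ≤ (1 / (cV * d) + 2 * C1V / cV) / 2 := by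
  have hf := H.qV.fpos x
  have hc := H.qV.c0p
  have hd := H.qV.p0
  rw [div_le_iff₀ hf]
  have h1 := H.Ve x e he
  have h2 : 1 ≤ 1 / (cV * d) * (d + V x) := by
    rw [one_div, inv_mul_eq_div, le_div_iff₀ (by positivity), one_mul]; exact H.fge x
  have h3 : |⟪gradient V x, e⟫| ≤ (1 + ⟪gradient V x, e⟫ ^ 2) / 2 := by
    rw [← sq_abs ⟪gradient V x, e⟫]; nlinarith [sq_nonneg (|⟪gradient V x, e⟫| - 1)]
  linarith

lemma Setup2.Qup (H : Setup2 V W φ d D cV CV cW CW CV2 cW2 C1V C1W β) (x e : Euc n) (he : ‖e‖ = 1)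
    (t : ℝ) : (d + V (x + t • e)) / (d + V x) ≤
      1 + t * ⟪gradient V x, e⟫ / (d + V x) + CV2 * t ^ 2 / (2 * (d + V x)) := by
  have hf := H.qV.fpos x
  have h1 := taylor_upper H.regV (CV2 * t ^ 2) x (t • e) (fun z => by
    have := H.hessV z (t • e)
    rwa [norm_smul, he, mul_one, Real.norm_eq_abs, sq_abs] at this)
  rw [inner_smul_right] at h1
  rw [div_le_iff₀ hf]
  have : (1 + t * ⟪gradient V x, e⟫ / (d + V x) + CV2 * t ^ 2 / (2 * (d + V x))) * (d + V x)
    = d + V x + t * ⟪gradient V x, e⟫ + CV2 * t ^ 2 / 2 := by field_simp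
  rw [this]; linarith

lemma Setup2.Plow (H : Setup2 V W φ d D cV CV cW CW CV2 cW2 C1V C1W β) (y e : Euc n) (he : ‖e‖ = 1)
    (s δ : ℝ) (hδ : 0 ≤ δ) :
    1 + s * ⟪gradient W y, e⟫ / (D + W y) + (cW2 / (2 * (D + W y)) * ((1 - δ) * s ^ 2)
      - (2 * C1W + 1 + cW2) / 2 / cW * δ)
     ≤ (D + W ((1 + δ) • y + s • e)) / (D + W y) := by
  have hg := H.qW.fpos y
  have hcw := H.qW.c0p
  have hc := H.hcW2
  have hC := H.hC1W
  have h1 := taylor_lower H.regW (cW2 * ‖δ • y + s • e‖ ^ 2) y (δ • y + s • e) (fun z => H.hessW z _)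
  have e1 : y + (δ • y + s • e) = (1 + δ) • y + s • e := by module
  rw [e1, inner_add_right, inner_smul_right, inner_smul_right] at h1
  have h2 : (1 - δ) * s ^ 2 - δ * ‖y‖ ^ 2 ≤ ‖δ • y + s • e‖ ^ 2 := by
    rw [norm_add_sq_real, norm_smul, norm_smul, he, inner_smul_left, inner_smul_right]
    simp only [Real.norm_eq_abs, mul_pow, sq_abs, RCLike.conj_to_real, mul_one, one_pow]
    have hi := (abs_le.1 (abs_real_inner_le_norm y e))
    rw [he, mul_one] at hi
    have hj := inner_sq_le y e he
    nlinarith [mul_nonneg hδ (sq_nonneg (s + ⟪y, e⟫)), sq_nonneg (δ * ‖y‖), mul_le_mul_of_nonneg_left hj hδ]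
  have h3 : -((2 * C1W + 1) / 2 * (D + ‖y‖ ^ 2)) ≤ ⟪gradient W y, y⟫ := by
    have hi := (abs_le.1 (abs_real_inner_le_norm (gradient W y) y)).1
    have := H.gradW y
    have hD := H.qW.p0
    nlinarith [sq_nonneg (‖gradient W y‖ - ‖y‖)]
  have h4 := H.normy y
  have h5 : ‖y‖ ^ 2 ≤ D + ‖y‖ ^ 2 := by have := H.qW.p0; linarith
  rw [le_div_iff₀ hg]
  have h6 : (1 + s * ⟪gradient W y, e⟫ / (D + W y) + (cW2 / (2 * (D + W y)) * ((1 - δ) * s ^ 2)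
      - (2 * C1W + 1 + cW2) / 2 / cW * δ)) * (D + W y) =
      D + W y + s * ⟪gradient W y, e⟫ + cW2 / 2 * ((1 - δ) * s ^ 2)
        - (2 * C1W + 1 + cW2) / 2 * δ * ((D + W y) / cW) := by
    field_simp
    ring
  rw [h6]
  have h7 : (2 * C1W + 1 + cW2) / 2 * δ * (D + ‖y‖ ^ 2) ≤ (2 * C1W + 1 + cW2) / 2 * δ * ((D + W y) / cW) := by
    gcongr
  have h8 := mul_le_mul_of_nonneg_left h2 hc.le
  have h9 := mul_le_mul_of_nonneg_left h3 hδ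
  have h10 : cW2 * δ * ‖y‖ ^ 2 ≤ cW2 * δ * (D + ‖y‖ ^ 2) := by gcongr
  nlinarith

set_option maxHeartbeats 1000000 in
lemma alg1 (α c f g h ε κ C1 CV2 Ve We A sB k : ℝ) (hα : 1 ≤ α) (hc : 0 < c) (hf : 0 < f)
    (hg : 0 < g) (hh : 0 < h) (hh1 : h ≤ 1) (hε : 0 < ε) (hε1 : ε ≤ 1) (hκ : 0 ≤ κ) (hC1 : 0 ≤ C1)
    (hk : |Ve| / f ≤ k) (hA : CV2 * g / (α * c * f) ≤ A) (hA0 : 0 ≤ A)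
    (hB : |Ve| * |We| / (c * f) ≤ sB)
    (H : α * (c / (2 * g) * ((1 - ε * h ^ 2 / 2) * (h * κ) ^ 2) - C1 * (ε * h ^ 2 / 2)) ≤
      ε * h ^ 2 / 2 + (1 + ε * h ^ 2 / 2) * (CV2 * h ^ 2 / (2 * f)) + |h * Ve / f| *
        (ε * h ^ 2 / 2 + CV2 * h ^ 2 / (2 * f) + α * |(h * κ) * We / g| + α * C1 * (ε * h ^ 2 / 2))) :
    (1 - ε) * κ ^ 2 ≤ (1 + ε) * (1 + k * h) * A + 2 * sB * κ + (C1 + 1) / c * (1 + k) * ε * g := by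
  have hα0 : 0 < α := by linarith
  have ea : |h * Ve / f| = h * (|Ve| / f) := by
    rw [abs_div, abs_mul, abs_of_pos hh, abs_of_pos hf]; ring
  have eb : |(h * κ) * We / g| = h * κ * |We| / g := by
    rw [abs_div, abs_mul, abs_of_nonneg (by positivity : 0 ≤ h * κ), abs_of_pos hg]
  rw [ea, eb] at H
  have hS : 0 < 2 * g / (α * c * h ^ 2) := by positivity
  have H2 := mul_le_mul_of_nonneg_left H hS.le
  have e1 : 2 * g / (α * c * h ^ 2) * (α * (c / (2 * g) * ((1 - ε * h ^ 2 / 2) * (h * κ) ^ 2) - C1 * (ε * h ^ 2 / 2)))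
     = (1 - ε * h ^ 2 / 2) * κ ^ 2 - C1 / c * ε * g := by
    field_simp
  have e2 : 2 * g / (α * c * h ^ 2) * (ε * h ^ 2 / 2 + (1 + ε * h ^ 2 / 2) * (CV2 * h ^ 2 / (2 * f)) + h * (|Ve| / f) *
        (ε * h ^ 2 / 2 + CV2 * h ^ 2 / (2 * f) + α * (h * κ * |We| / g) + α * C1 * (ε * h ^ 2 / 2)))
     = 1 / (α * c) * ε * g + (1 + ε * h ^ 2 / 2) * (CV2 * g / (α * c * f)) +
       h * (|Ve| / f) * (1 / (α * c) * ε * g + CV2 * g / (α * c * f) + C1 / c * ε * g)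
       + 2 * (|Ve| * |We| / (c * f)) * κ := by
    field_simp
    ring
  rw [e1, e2] at H2
  have hV0 : 0 ≤ |Ve| / f := by positivity
  have hk0 : 0 ≤ k := hV0.trans hk
  have i1 : 1 / (α * c) ≤ 1 / c := by
    apply one_div_le_one_div_of_le hc; nlinarith
  have hh2 : h ^ 2 ≤ 1 := pow_le_one₀ hh.le hh1
  have hεh : ε * h ^ 2 ≤ ε := mul_le_of_le_one_right hε.le hh2
  have i2 : (1 + ε * h ^ 2 / 2) * (CV2 * g / (α * c * f)) ≤ (1 + ε) * A := by
    calc _ ≤ (1 + ε * h ^ 2 / 2) * A := by gcongr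
      _ ≤ _ := by
        apply mul_le_mul_of_nonneg_right _ hA0; linarith
  have i3 : 1 / (α * c) * ε * g ≤ 1 / c * ε * g := by gcongr
  have i4 : h * (|Ve| / f) * (1 / (α * c) * ε * g + CV2 * g / (α * c * f) + C1 / c * ε * g) ≤
      h * k * (1 / c * ε * g + A + C1 / c * ε * g) := by
    calc _ ≤ h * (|Ve| / f) * (1 / c * ε * g + A + C1 / c * ε * g) := by gcongr
      _ ≤ _ := by gcongr
  have i5 : h * k * (1 / c * ε * g + C1 / c * ε * g) ≤ 1 * k * (1 / c * ε * g + C1 / c * ε * g) := by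
    gcongr
  have i6 : 2 * (|Ve| * |We| / (c * f)) * κ ≤ 2 * sB * κ := by gcongr
  have i7 : (1 - ε) * κ ^ 2 ≤ (1 - ε * h ^ 2 / 2) * κ ^ 2 := by
    apply mul_le_mul_of_nonneg_right _ (sq_nonneg κ); linarith
  have i8 : 0 ≤ ε * (k * h) * A := by positivity
  have e3 : (C1 + 1) / c * (1 + k) * ε * g = (1 / c * ε * g + C1 / c * ε * g) * (1 + k) := by ring
  rw [e3]
  generalize 1 / c * ε * g = p1 at *
  generalize C1 / c * ε * g = p2 at *
  linarith

set_option maxHeartbeats 1000000 in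
lemma alg2 (α c f g h ε κ C1 CV2 Ve Γ A B2 k : ℝ) (hα : 1 ≤ α) (hc : 0 < c) (hf : 0 < f)
    (hg : 0 < g) (hh : 0 < h) (hh1 : h ≤ 1) (hε : 0 < ε) (hε1 : ε ≤ 1) (hC1 : 0 ≤ C1)
    (hCV2 : 0 ≤ CV2) (hΓ : 0 ≤ Γ)
    (hk : CV2 / (2 * f) ≤ k) (hA : CV2 * g / (α * c * f) ≤ A) (hA0 : 0 ≤ A) (hB0 : 0 ≤ B2)
    (hB : 4 * Γ * g * Ve ^ 2 / (α * c * f ^ 2) ≤ 2 * B2)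
    (H : α * (c / (2 * g) * ((1 - ε * h ^ 2 / 2) * (h * κ) ^ 2) - C1 * (ε * h ^ 2 / 2)) ≤
      ε * h ^ 2 / 2 + (1 + ε * h ^ 2 / 2) * (CV2 * h ^ 2 / (2 * f) + 2 * Γ * ((h * Ve / f) ^ 2
         + (CV2 * h ^ 2 / (2 * f)) ^ 2))) :
    (1 - ε) * κ ^ 2 ≤ (1 + ε) * (1 + 2 * Γ * k * h) * (A + 2 * B2) + (C1 + 1) / c * ε * g := by
  have hα0 : 0 < α := by linarith
  have hS : 0 < 2 * g / (α * c * h ^ 2) := by positivity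
  have H2 := mul_le_mul_of_nonneg_left H hS.le
  have e1 : 2 * g / (α * c * h ^ 2) * (α * (c / (2 * g) * ((1 - ε * h ^ 2 / 2) * (h * κ) ^ 2) - C1 * (ε * h ^ 2 / 2)))
     = (1 - ε * h ^ 2 / 2) * κ ^ 2 - C1 / c * ε * g := by
    field_simp
  have e2 : 2 * g / (α * c * h ^ 2) * (ε * h ^ 2 / 2 + (1 + ε * h ^ 2 / 2) * (CV2 * h ^ 2 / (2 * f) + 2 * Γ * ((h * Ve / f) ^ 2
         + (CV2 * h ^ 2 / (2 * f)) ^ 2)))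
     = 1 / (α * c) * ε * g + (1 + ε * h ^ 2 / 2) * (CV2 * g / (α * c * f) * (1 + 2 * Γ * (CV2 / (2 * f)) * h ^ 2)
        + 4 * Γ * g * Ve ^ 2 / (α * c * f ^ 2)) := by
    field_simp
    ring
  rw [e1, e2] at H2
  have hk0 : 0 ≤ k := le_trans (by positivity) hk
  have i1 : 1 / (α * c) ≤ 1 / c := by
    apply one_div_le_one_div_of_le hc; nlinarith
  have hh2 : h ^ 2 ≤ h := by rw [sq]; exact mul_le_of_le_one_left hh.le hh1
  have hh3 : h ^ 2 ≤ 1 := pow_le_one₀ hh.le hh1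
  have hεh : ε * h ^ 2 ≤ ε := mul_le_of_le_one_right hε.le hh3
  have i3 : 1 / (α * c) * ε * g ≤ 1 / c * ε * g := by gcongr
  have i4 : CV2 * g / (α * c * f) * (1 + 2 * Γ * (CV2 / (2 * f)) * h ^ 2)
        + 4 * Γ * g * Ve ^ 2 / (α * c * f ^ 2) ≤ (1 + 2 * Γ * k * h) * (A + 2 * B2) := by
    calc _ ≤ A * (1 + 2 * Γ * k * h) + 2 * B2 := by gcongr
      _ ≤ _ := by
        have : 0 ≤ 2 * Γ * k * h * (2 * B2) := by positivity
        linarith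
  have i5 : (1 + ε * h ^ 2 / 2) * (CV2 * g / (α * c * f) * (1 + 2 * Γ * (CV2 / (2 * f)) * h ^ 2)
        + 4 * Γ * g * Ve ^ 2 / (α * c * f ^ 2)) ≤ (1 + ε) * ((1 + 2 * Γ * k * h) * (A + 2 * B2)) := by
    apply mul_le_mul _ i4 (by positivity) (by positivity)
    linarith
  have i7 : (1 - ε) * κ ^ 2 ≤ (1 - ε * h ^ 2 / 2) * κ ^ 2 := by
    apply mul_le_mul_of_nonneg_right _ (sq_nonneg κ); linarith
  have e3 : (C1 + 1) / c * ε * g = (1 / c * ε * g + C1 / c * ε * g) := by ring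
  rw [e3]
  linarith

/-- What holds at the maximum points. -/
def AtMax (φ : Euc n → ℝ) (m a0 b0 : ℝ) : Prop :=
  ∃ h0 k C : ℝ, 0 < h0 ∧ 0 ≤ k ∧ 0 ≤ C ∧ ∀ h ε κ : ℝ, 0 < h → h ≤ h0 → 0 < ε → ε ≤ 1 → 0 ≤ κ →
    ∀ x e : Euc n, ‖e‖ = 1 →
    gradient φ (x + h • e) = (1 + ε * h ^ 2 / 2) • gradient φ x + (h * κ) • e →
    gradient φ (x - h • e) = (1 + ε * h ^ 2 / 2) • gradient φ x - (h * κ) • e →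
    (∀ v, hess φ (x + h • e) v + hess φ (x - h • e) v ≤ 2 * (1 + ε * h ^ 2 / 2) * hess φ x v) →
    (1 - ε) * κ ^ 2 ≤ (1 + ε) * (1 + k * h) * a0 + b0 * κ + C * ε * (1 + φ x - m)

set_option maxHeartbeats 2000000 in
lemma Setup2.atMax (H : Setup2 V W φ d D cV CV cW CW CV2 cW2 C1V C1W β) (m G : ℝ) (hG : 0 < G)
    (hm : ∀ x, m ≤ φ x) (hGr : ∀ x, ‖gradient φ x‖ ^ 2 ≤ G * (1 + φ x - m)) :
    (AtMax φ m (CV2 * CW * β / (D / d * cW2 * cV)) (2 * Real.sqrt (4 * C1V * C1W * β / (cW2 ^ 2 * cV ^ 2))))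
    ∧ (∀ Γ : ℝ, 0 ≤ Γ → d < D → 1 ≤ (D / d - 1) * (1 + Γ) →
      AtMax φ m (CV2 * CW * β / (D / d * cW2 * cV) + 2 * (4 * C1V * CW * β * Γ / (D / d * cW2 * cV ^ 2))) 0) := by
  have hd := H.qV.p0
  have hD := H.qW.p0
  have hcV := H.qV.c0p
  have hcW := H.qW.c0p
  have hCW := H.qW.C0p
  have hβ := H.hβ
  have hcW2 := H.hcW2
  have hCV2 := H.hCV2
  have hC1V := H.hC1V
  have hC1W := H.hC1W
  have hα : 1 ≤ D / d := by rw [le_div_iff₀ hd, one_mul]; exact H.hdD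
  have hα0 : 0 < D / d := by linarith
  set α := D / d with hαdef
  set A := CV2 * CW * β / (α * cW2 * cV) with hA
  have hA0 : 0 ≤ A := by positivity
  set C1 := (2 * C1W + 1 + cW2) / 2 / cW with hC1
  have hC10 : 0 ≤ C1 := by positivity
  set k := (1 / (cV * d) + 2 * C1V / cV) / 2 with hk
  have hk0 : 0 ≤ k := by positivity
  set k2 := CV2 / (2 * (cV * d)) with hk2
  have hk20 : 0 ≤ k2 := by positivity
  have hgm : ∀ x, D + W (gradient φ x) ≤ CW * (D + G) * (1 + φ x - m) := by
    intro x
    have h1 := H.qW.up (gradient φ x)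
    have h2 := hGr x
    have h3 := hm x
    calc _ ≤ _ := h1
      _ ≤ CW * (D * (1 + φ x - m) + G * (1 + φ x - m)) := by
        gcongr; nlinarith
      _ = _ := by ring
  have hAx : ∀ x, CV2 * (D + W (gradient φ x)) / (α * cW2 * (d + V x)) ≤ A := by
    intro x
    have hf := H.qV.fpos x
    rw [div_le_iff₀ (by positivity)]
    calc _ ≤ CV2 * (CW * β / cV * (d + V x)) := by gcongr; exact H.gf x
      _ = _ := by rw [hA]; field_simp
  have hq2 : ∀ x, CV2 / (2 * (d + V x)) ≤ k2 := by
    intro x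
    rw [hk2]; gcongr; exact H.fge x
  -- common facts
  have common : ∀ h ε κ : ℝ, 0 < h → h ≤ 1 → 0 < ε → ε ≤ 1 → 0 ≤ κ → ∀ x e : Euc n, ‖e‖ = 1 →
    gradient φ (x + h • e) = (1 + ε * h ^ 2 / 2) • gradient φ x + (h * κ) • e →
    gradient φ (x - h • e) = (1 + ε * h ^ 2 / 2) • gradient φ x - (h * κ) • e →
    (∀ v, hess φ (x + h • e) v + hess φ (x - h • e) v ≤ 2 * (1 + ε * h ^ 2 / 2) * hess φ x v) →
    ((D + W (gradient φ (x + h • e))) / (D + W (gradient φ x))) ^ α / ((d + V (x + h • e)) / (d + V x))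
    + ((D + W (gradient φ (x - h • e))) / (D + W (gradient φ x))) ^ α / ((d + V (x - h • e)) / (d + V x))
      ≤ 2 * (1 + ε * h ^ 2 / 2) ∧
    (d + V (x + h • e)) / (d + V x) ≤ 1 + h * ⟪gradient V x, e⟫ / (d + V x) + CV2 * h ^ 2 / (2 * (d + V x)) ∧
    (d + V (x - h • e)) / (d + V x) ≤ 1 - h * ⟪gradient V x, e⟫ / (d + V x) + CV2 * h ^ 2 / (2 * (d + V x)) ∧
    1 + (h * κ) * ⟪gradient W (gradient φ x), e⟫ / (D + W (gradient φ x))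
      + (cW2 / (2 * (D + W (gradient φ x))) * ((1 - ε * h ^ 2 / 2) * (h * κ) ^ 2) - C1 * (ε * h ^ 2 / 2))
      ≤ (D + W (gradient φ (x + h • e))) / (D + W (gradient φ x)) ∧
    1 - (h * κ) * ⟪gradient W (gradient φ x), e⟫ / (D + W (gradient φ x))
      + (cW2 / (2 * (D + W (gradient φ x))) * ((1 - ε * h ^ 2 / 2) * (h * κ) ^ 2) - C1 * (ε * h ^ 2 / 2))
      ≤ (D + W (gradient φ (x - h • e))) / (D + W (gradient φ x)) := by
    intro h ε κ hh hh1 hε hε1 hκ x e he g1 g2 hess_le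
    refine ⟨H.scalar _ (by have : 0 ≤ ε * h ^ 2 / 2 := by positivity
                           linarith) x _ _ hess_le, H.Qup x e he h, ?_, ?_, ?_⟩
    · have := H.Qup x e he (-h)
      rw [neg_smul, ← sub_eq_add_neg, neg_sq, neg_mul, neg_div, ← sub_eq_add_neg] at this
      exact this
    · rw [g1]
      exact H.Plow (gradient φ x) e he (h * κ) (ε * h ^ 2 / 2) (by positivity)
    · rw [g2]
      have := H.Plow (gradient φ x) e he (-(h * κ)) (ε * h ^ 2 / 2) (by positivity)
      rw [neg_smul, ← sub_eq_add_neg, neg_sq, neg_mul, neg_div, ← sub_eq_add_neg] at this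
      exact this
  constructor
  · refine ⟨1, k, (C1 + 1) / cW2 * (1 + k) * (CW * (D + G)), one_pos, hk0, by positivity, ?_⟩
    intro h ε κ hh hh1 hε hε1 hκ x e he g1 g2 hess_le
    obtain ⟨hs, q1, q2, p1, p2⟩ := common h ε κ hh hh1 hε hε1 hκ x e he g1 g2 hess_le
    have hf := H.qV.fpos x
    have hg := H.qW.fpos (gradient φ x)
    have hδ1 : ε * h ^ 2 / 2 ≤ 1 := by
      have := mul_le_one₀ hε1 (sq_nonneg h) (pow_le_one₀ hh.le hh1 : h ^ 2 ≤ 1)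
      linarith
    have o := opt1 α (ε * h ^ 2 / 2) _ _ _ _ C1 _ _ _ _ hα (by positivity) (by positivity) hC10
      (by
        have : 0 ≤ cW2 / (2 * (D + W (gradient φ x))) * ((1 - ε * h ^ 2 / 2) * (h * κ) ^ 2) := by
          have : 0 ≤ 1 - ε * h ^ 2 / 2 := by linarith
          positivity
        linarith)
      (div_pos (H.qW.fpos _) hg) (div_pos (H.qW.fpos _) hg)
      (div_pos (H.qV.fpos _) hf) (div_pos (H.qV.fpos _) hf) hs q1 q2 p1 p2
    have hB : |⟪gradient V x, e⟫| * |⟪gradient W (gradient φ x), e⟫| / (cW2 * (d + V x)) ≤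
        Real.sqrt (4 * C1V * C1W * β / (cW2 ^ 2 * cV ^ 2)) := by
      apply Real.le_sqrt_of_sq_le
      rw [div_pow, mul_pow, sq_abs, sq_abs, div_le_iff₀ (by positivity)]
      calc _ ≤ (2 * C1V / cV * (d + V x)) * (2 * C1W * β / cV * (d + V x)) := by
            gcongr
            · exact H.Ve x e he
            · exact H.We x e he
        _ = _ := by field_simp; ring
    have := alg1 α cW2 (d + V x) (D + W (gradient φ x)) h ε κ C1 CV2 _ _ A _ k hα hcW2 hf hg hh hh1
      hε hε1 hκ hC10 (H.Vk x e he) (hAx x) hA0 hB o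
    refine this.trans ?_
    have h2 : (C1 + 1) / cW2 * (1 + k) * ε * (D + W (gradient φ x)) ≤
        (C1 + 1) / cW2 * (1 + k) * ε * (CW * (D + G) * (1 + φ x - m)) := by
      gcongr; exact hgm x
    linarith
  · intro Γ hΓ hdD' hαΓ
    have hα1 : 1 < α := by rw [hαdef, lt_div_iff₀ hd, one_mul]; exact hdD'
    refine ⟨1 / (1 + 2 * Γ * (k + k2)), 2 * Γ * k2, (C1 + 1) / cW2 * (CW * (D + G)), by positivity,
      by positivity, by positivity, ?_⟩
    intro h ε κ hh hh0 hε hε1 hκ x e he g1 g2 hess_le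
    have hden : 0 < 1 + 2 * Γ * (k + k2) := by positivity
    rw [le_div_iff₀ hden] at hh0
    have hh1 : h ≤ 1 := by
      have : 0 ≤ h * (2 * Γ * (k + k2)) := by positivity
      linarith
    obtain ⟨hs, q1, q2, p1, p2⟩ := common h ε κ hh hh1 hε hε1 hκ x e he g1 g2 hess_le
    have hf := H.qV.fpos x
    have hg := H.qW.fpos (gradient φ x)
    have o := opt2 α (ε * h ^ 2 / 2) Γ _ _ _ _ _ _ _ _ hα1 (by positivity) (by positivity) hΓ hαΓ
      (div_pos (H.qW.fpos _) hg) (div_pos (H.qW.fpos _) hg)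
      (div_pos (H.qV.fpos _) hf) (div_pos (H.qV.fpos _) hf) hs q1 q2 p1 p2 (by
        have ea : |h * ⟪gradient V x, e⟫ / (d + V x)| ≤ h * k := by
          rw [abs_div, abs_mul, abs_of_pos hh, abs_of_pos hf, mul_div_assoc]
          gcongr; exact H.Vk x e he
        have eq : CV2 * h ^ 2 / (2 * (d + V x)) ≤ h * k2 := by
          have e1 : CV2 * h ^ 2 / (2 * (d + V x)) = h ^ 2 * (CV2 / (2 * (d + V x))) := by ring
          rw [e1]
          have h2 : h ^ 2 ≤ h := by rw [sq]; exact mul_le_of_le_one_left hh.le hh1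
          calc _ ≤ h ^ 2 * k2 := by gcongr; exact hq2 x
            _ ≤ _ := by gcongr
        have : Γ * (|h * ⟪gradient V x, e⟫ / (d + V x)| + CV2 * h ^ 2 / (2 * (d + V x))) ≤ Γ * (h * k + h * k2) := by
          gcongr
        linarith)
    have hB : 4 * Γ * (D + W (gradient φ x)) * ⟪gradient V x, e⟫ ^ 2 / (α * cW2 * (d + V x) ^ 2) ≤
        2 * (4 * C1V * CW * β * Γ / (α * cW2 * cV ^ 2)) := by
      rw [div_le_iff₀ (by positivity)]
      calc _ ≤ 4 * Γ * (CW * β / cV * (d + V x)) * (2 * C1V / cV * (d + V x)) := by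
            gcongr
            · exact H.gf x
            · exact H.Ve x e he
        _ = _ := by field_simp
    have := alg2 α cW2 (d + V x) (D + W (gradient φ x)) h ε κ C1 CV2 _ Γ A _ k2 hα hcW2 hf hg hh hh1
      hε hε1 hC10 hCV2.le hΓ (hq2 x) (hAx x) hA0 (by positivity) hB o
    refine this.trans ?_
    have h2 : (C1 + 1) / cW2 * ε * (D + W (gradient φ x)) ≤
        (C1 + 1) / cW2 * ε * (CW * (D + G) * (1 + φ x - m)) := by
      gcongr; exact hgm x
    linarith

end AtMax

section Concl
variable {n : ℕ}

/-- Second difference. -/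
def SD (φ : Euc n → ℝ) (h : ℝ) (x e : Euc n) : ℝ := φ (x + h • e) + φ (x - h • e) - 2 * φ x

lemma SD_nonneg {φ : Euc n → ℝ} (hφ : ContDiff ℝ 2 φ) (hc : ConvexOn ℝ univ φ) (h : ℝ) (x e : Euc n) :
    0 ≤ SD φ h x e := by
  have h1 := grad_ineq hφ hc x (x + h • e)
  have h2 := grad_ineq hφ hc x (x - h • e)
  have e1 : x + h • e - x = h • e := by module
  have e2 : x - h • e - x = -(h • e) := by module
  rw [e1] at h1
  rw [e2, inner_neg_right] at h2
  unfold SD; linarith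

lemma SD_le {φ : Euc n → ℝ} (hφ : ContDiff ℝ 2 φ) (Λ : ℝ) (hΛ : ∀ x e, ‖e‖ = 1 → hess φ x e ≤ Λ)
    (h : ℝ) (x e : Euc n) (he : ‖e‖ = 1) : SD φ h x e ≤ Λ * h ^ 2 := by
  have hs : ∀ (s : ℝ) (z : Euc n), hess φ z (s • e) ≤ Λ * s ^ 2 := by
    intro s z
    have : hess φ z (s • e) = s ^ 2 * hess φ z e := by
      rw [hess_eq_inner hφ, hess_eq_inner hφ, map_smul, inner_smul_left, inner_smul_right]
      simp; ring
    rw [this]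
    nlinarith [mul_le_mul_of_nonneg_left (hΛ z e he) (sq_nonneg s)]
  have h1 := taylor_upper hφ (Λ * h ^ 2) x (h • e) (hs h)
  have h2 := taylor_upper hφ (Λ * (-h) ^ 2) x ((-h) • e) (hs (-h))
  rw [neg_smul, ← sub_eq_add_neg, inner_neg_right] at h2
  unfold SD; nlinarith

lemma SD_lower {φ : Euc n → ℝ} (hφ : ContDiff ℝ 2 φ) (hc : ConvexOn ℝ univ φ) (h κ θ : ℝ) (x e : Euc n)
    (hk : ⟪gradient φ (x + h • e), e⟫ - ⟪gradient φ (x - h • e), e⟫ = 2 * h * κ) :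
    SD φ h x e ≤ SD φ ((1 - θ) * h) x e + θ * h * (2 * h * κ) := by
  have h1 := grad_ineq hφ hc (x + h • e) (x + ((1 - θ) * h) • e)
  have h2 := grad_ineq hφ hc (x - h • e) (x - ((1 - θ) * h) • e)
  have e1 : x + ((1 - θ) * h) • e - (x + h • e) = (-(θ * h)) • e := by module
  have e2 : x - ((1 - θ) * h) • e - (x - h • e) = (θ * h) • e := by module
  rw [e1, inner_smul_right] at h1
  rw [e2, inner_smul_right] at h2
  unfold SD
  rw [← hk]
  linarith

lemma ev_pos : ∀ᶠ t in 𝓝[>] (0 : ℝ), 0 < t := self_mem_nhdsWithin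

lemma ev_small (c b : ℝ) (hb : 0 < b) : ∀ᶠ t in 𝓝[>] (0 : ℝ), c * t ≤ b := by
  have : Tendsto (fun t : ℝ => c * t) (𝓝[>] 0) (𝓝 (c * 0)) :=
    ((continuous_const.mul continuous_id).tendsto 0).mono_left nhdsWithin_le_nhds
  rw [mul_zero] at this
  filter_upwards [this.eventually (gt_mem_nhds hb)] with t ht using ht.le

lemma max_step {φ : Euc n → ℝ} (hφ : ContDiff ℝ 2 φ) (hc : ConvexOn ℝ univ φ)
    (hex : ∀ h δ : ℝ, 0 < h → 0 < δ → ∃ x e : Euc n, ‖e‖ = 1 ∧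
      ∀ x' e', ‖e'‖ = 1 → Phi φ (1 + δ) h x' e' ≤ Phi φ (1 + δ) h x e)
    {m a0 b0 h0 k C : ℝ}
    (hat : ∀ h ε κ : ℝ, 0 < h → h ≤ h0 → 0 < ε → ε ≤ 1 → 0 ≤ κ →
    ∀ x e : Euc n, ‖e‖ = 1 →
    gradient φ (x + h • e) = (1 + ε * h ^ 2 / 2) • gradient φ x + (h * κ) • e →
    gradient φ (x - h • e) = (1 + ε * h ^ 2 / 2) • gradient φ x - (h * κ) • e →
    (∀ v, hess φ (x + h • e) v + hess φ (x - h • e) v ≤ 2 * (1 + ε * h ^ 2 / 2) * hess φ x v) →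
    (1 - ε) * κ ^ 2 ≤ (1 + ε) * (1 + k * h) * a0 + b0 * κ + C * ε * (1 + φ x - m))
    (h ε : ℝ) (hh : 0 < h) (hh0 : h ≤ h0) (hε : 0 < ε) (hε1 : ε ≤ 1) :
    ∃ x e : Euc n, ∃ κ : ℝ, ‖e‖ = 1 ∧ 0 ≤ κ ∧
      ⟪gradient φ (x + h • e), e⟫ - ⟪gradient φ (x - h • e), e⟫ = 2 * h * κ ∧
      (1 - ε) * κ ^ 2 ≤ (1 + ε) * (1 + k * h) * a0 + b0 * κ + C * ε * (1 + φ x - m) ∧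
      ∀ x' e', ‖e'‖ = 1 → SD φ h x' e' - ε * h ^ 2 * φ x' ≤ SD φ h x e - ε * h ^ 2 * φ x := by
  obtain ⟨x, e, he, hmax⟩ := hex h (ε * h ^ 2 / 2) hh (by positivity)
  obtain ⟨⟨κ, hκ, g1, g2⟩, hv⟩ := Phi_max_cond hφ hc h _ hh x e he hmax
  refine ⟨x, e, κ, he, hκ, ?_, hat h ε κ hh hh0 hε hε1 hκ x e he g1 g2 hv, ?_⟩
  · rw [g1, g2, inner_add_left, inner_sub_left]
    simp only [inner_smul_left, RCLike.conj_to_real, real_inner_self_eq_norm_sq, he]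
    ring
  · intro x' e' he'
    have := hmax x' e' he'
    unfold Phi at this
    unfold SD; linarith

lemma sq_bound (P Q κ : ℝ) (hP : 0 ≤ P) (hQ : 0 ≤ Q) (h : κ ^ 2 ≤ P + Q * κ) : κ ≤ P + Q + 1 := by
  by_contra hc
  push Not at hc
  nlinarith [mul_nonneg hP (by linarith : 0 ≤ κ - 1)]

lemma AtMax.bounded {φ : Euc n → ℝ} (hφ : ContDiff ℝ 2 φ) (hc : ConvexOn ℝ univ φ)
    (hex : ∀ h δ : ℝ, 0 < h → 0 < δ → ∃ x e : Euc n, ‖e‖ = 1 ∧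
      ∀ x' e', ‖e'‖ = 1 → Phi φ (1 + δ) h x' e' ≤ Phi φ (1 + δ) h x e)
    {m a0 b0 h0 k C : ℝ} (hm : ∀ x, m ≤ φ x) (ha : 0 ≤ a0) (hb : 0 ≤ b0) (hh0 : 0 < h0) (hk : 0 ≤ k) (hC : 0 ≤ C)
    (hat : ∀ h ε κ : ℝ, 0 < h → h ≤ h0 → 0 < ε → ε ≤ 1 → 0 ≤ κ →
    ∀ x e : Euc n, ‖e‖ = 1 →
    gradient φ (x + h • e) = (1 + ε * h ^ 2 / 2) • gradient φ x + (h * κ) • e →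
    gradient φ (x - h • e) = (1 + ε * h ^ 2 / 2) • gradient φ x - (h * κ) • e →
    (∀ v, hess φ (x + h • e) v + hess φ (x - h • e) v ≤ 2 * (1 + ε * h ^ 2 / 2) * hess φ x v) →
    (1 - ε) * κ ^ 2 ≤ (1 + ε) * (1 + k * h) * a0 + b0 * κ + C * ε * (1 + φ x - m)) :
    ∃ R : ℝ, 0 ≤ R ∧ (∀ x e, ‖e‖ = 1 → hess φ x e ≤ 2 * R) ∧
      ∀ h ε : ℝ, 0 < h → h ≤ h0 → 0 < ε → ε ≤ 1 / 2 →
      ∃ x e : Euc n, ∃ κ : ℝ, ‖e‖ = 1 ∧ 0 ≤ κ ∧ κ ≤ R ∧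
      ⟪gradient φ (x + h • e), e⟫ - ⟪gradient φ (x - h • e), e⟫ = 2 * h * κ ∧
      (1 - ε) * κ ^ 2 ≤ (1 + ε) * (1 + k * h) * a0 + b0 * κ + C * ε * (1 + φ x - m) ∧
      ∀ x' e', ‖e'‖ = 1 → SD φ h x' e' - ε * h ^ 2 * φ x' ≤ SD φ h x e - ε * h ^ 2 * φ x := by
  have hm0 := hm 0
  set P := 2 * (2 * (1 + k * h0) * a0 + C * (1 + (φ 0 - m))) with hP
  have hP0 : 0 ≤ P := by
    have : 0 ≤ φ 0 - m := by linarith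
    positivity
  set Q := 2 * (b0 + 2 * C) with hQ
  have hQ0 : 0 ≤ Q := by positivity
  have key : ∀ h ε : ℝ, 0 < h → h ≤ h0 → 0 < ε → ε ≤ 1 / 2 →
      ∃ x e : Euc n, ∃ κ : ℝ, ‖e‖ = 1 ∧ 0 ≤ κ ∧ κ ≤ P + Q + 1 ∧
      ⟪gradient φ (x + h • e), e⟫ - ⟪gradient φ (x - h • e), e⟫ = 2 * h * κ ∧
      (1 - ε) * κ ^ 2 ≤ (1 + ε) * (1 + k * h) * a0 + b0 * κ + C * ε * (1 + φ x - m) ∧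
      ∀ x' e', ‖e'‖ = 1 → SD φ h x' e' - ε * h ^ 2 * φ x' ≤ SD φ h x e - ε * h ^ 2 * φ x := by
    intro h ε hh hhh0 hε hε1
    obtain ⟨x, e, κ, he, hκ, hgr, hin, hmax⟩ := max_step hφ hc hex hat h ε hh hhh0 hε (by linarith)
    refine ⟨x, e, κ, he, hκ, ?_, hgr, hin, hmax⟩
    have h1 := SD_lower hφ hc h κ 1 x e hgr
    have h2 : SD φ ((1 - 1) * h) x e = 0 := by unfold SD; simp; ring
    rw [h2] at h1
    have h3 := hmax 0 e he
    have h4 := SD_nonneg hφ hc h 0 e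
    have h5 : h ^ 2 * (ε * (φ x - m)) ≤ h ^ 2 * (2 * κ + ε * (φ 0 - m)) := by linarith
    have h6 := le_of_mul_le_mul_left h5 (by positivity)
    have h7 : ε * (φ 0 - m) ≤ 1 * (φ 0 - m) := mul_le_mul_of_nonneg_right (by linarith) (by linarith)
    have h8 : C * ε * (1 + φ x - m) ≤ C * (1 + (2 * κ + (φ 0 - m))) := by
      calc _ = C * (ε + ε * (φ x - m)) := by ring
        _ ≤ _ := by
          apply mul_le_mul_of_nonneg_left _ hC; linarith
    have h9 : (1 + ε) * (1 + k * h) * a0 ≤ 2 * (1 + k * h0) * a0 := by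
      gcongr; linarith
    have h10 : 1 / 2 * κ ^ 2 ≤ (1 - ε) * κ ^ 2 := mul_le_mul_of_nonneg_right (by linarith) (sq_nonneg _)
    apply sq_bound P Q κ hP0 hQ0
    rw [hP, hQ]; linarith
  refine ⟨P + Q + 1, by positivity, ?_, key⟩
  intro x1 e1 he1
  have hSD : ∀ h, 0 < h → h ≤ h0 → SD φ h x1 e1 ≤ 2 * (P + Q + 1) * h ^ 2 := by
    intro h hh hhh0
    have ev : ∀ᶠ ε in 𝓝[>] (0 : ℝ), SD φ h x1 e1 ≤ 2 * (P + Q + 1) * h ^ 2 + h ^ 2 * (φ x1 - m) * ε := by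
      filter_upwards [self_mem_nhdsWithin, ev_small 1 (1 / 2) (by norm_num)] with ε hε hε1
      rw [mem_Ioi] at hε
      obtain ⟨x, e, κ, he, hκ, hκR, hgr, hin, hmax⟩ := key h ε hh hhh0 hε (by linarith)
      have h1 := SD_lower hφ hc h κ 1 x e hgr
      have h2 : SD φ ((1 - 1) * h) x e = 0 := by unfold SD; simp; ring
      rw [h2] at h1
      have h3 := hmax x1 e1 he1
      have h4 : ε * h ^ 2 * m ≤ ε * h ^ 2 * φ x := mul_le_mul_of_nonneg_left (hm x) (by positivity)
      have h5 : h ^ 2 * κ ≤ h ^ 2 * (P + Q + 1) := mul_le_mul_of_nonneg_left hκR (by positivity)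
      linarith
    have tt : Tendsto (fun ε : ℝ => 2 * (P + Q + 1) * h ^ 2 + h ^ 2 * (φ x1 - m) * ε) (𝓝[>] 0)
        (𝓝 (2 * (P + Q + 1) * h ^ 2 + h ^ 2 * (φ x1 - m) * 0)) :=
      ((by fun_prop : Continuous fun ε : ℝ => 2 * (P + Q + 1) * h ^ 2 + h ^ 2 * (φ x1 - m) * ε).tendsto 0).mono_left
        nhdsWithin_le_nhds
    have := ge_of_tendsto tt ev
    linarith
  apply le_of_tendsto (tendsto_secdiff hφ x1 e1)
  filter_upwards [self_mem_nhdsWithin, ev_small 1 h0 hh0] with t ht ht0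
  rw [mem_Ioi] at ht
  rw [div_le_iff₀ (by positivity)]
  exact hSD t ht (by linarith)

lemma AtMax.concl {φ : Euc n → ℝ} (hφ : ContDiff ℝ 2 φ) (hc : ConvexOn ℝ univ φ)
    (hex : ∀ h δ : ℝ, 0 < h → 0 < δ → ∃ x e : Euc n, ‖e‖ = 1 ∧
      ∀ x' e', ‖e'‖ = 1 → Phi φ (1 + δ) h x' e' ≤ Phi φ (1 + δ) h x e)
    {m a0 b0 : ℝ} (hm : ∀ x, m ≤ φ x) (ha : 0 ≤ a0) (hb : 0 ≤ b0) (hA : AtMax φ m a0 b0)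
    (L : ℝ) (hL : ∀ l : ℝ, 0 ≤ l → l ^ 2 ≤ a0 + b0 * l → l ≤ L) (x0 e0 : Euc n) (he0 : ‖e0‖ = 1) :
    hess φ x0 e0 ≤ L := by
  obtain ⟨h0, k, C, hh0, hk, hC, hat⟩ := hA
  obtain ⟨R, hR0, hR, key⟩ := AtMax.bounded hφ hc hex hm ha hb hh0 hk hC hat
  set S : Set ℝ := {t | ∃ x e : Euc n, ‖e‖ = 1 ∧ hess φ x e = t} with hS
  have hbdd : BddAbove S := by
    refine ⟨2 * R, ?_⟩
    rintro t ⟨x, e, he, rfl⟩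
    exact hR x e he
  have hne : S.Nonempty := ⟨_, x0, e0, he0, rfl⟩
  set Λ := sSup S with hΛdef
  have hΛ : ∀ x e, ‖e‖ = 1 → hess φ x e ≤ Λ := fun x e he => le_csSup hbdd ⟨x, e, he, rfl⟩
  have hΛ0 : 0 ≤ Λ := (hess_nonneg hφ hc x0 e0).trans (hΛ x0 e0 he0)
  have main : ∀ η : ℝ, 0 < η → ∃ κ : ℝ, Λ - η ≤ κ ∧ κ ^ 2 ≤ a0 + b0 * κ + η := by
    intro η hη
    obtain ⟨θ, hθ, hθ1, hθ2, hθ3⟩ : ∃ θ : ℝ, 0 < θ ∧ 1 * θ ≤ 1 ∧ (Λ / 2 + 1) * θ ≤ η ∧ 2 * C * θ ≤ η / 3 := by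
      have := ((ev_pos.and (ev_small 1 1 one_pos)).and
        ((ev_small (Λ / 2 + 1) η hη).and (ev_small (2 * C) (η / 3) (by positivity)))).exists
      obtain ⟨t, ⟨h1, h2⟩, h3, h4⟩ := this
      exact ⟨t, h1, h2, h3, h4⟩
    have hθθ : θ ^ 2 ≤ θ := by nlinarith
    obtain ⟨_, ⟨x1, e1, he1, rfl⟩, hx1⟩ := exists_lt_of_lt_csSup hne (show Λ - θ ^ 2 < sSup S by
      rw [← hΛdef]; have : 0 < θ ^ 2 := by positivity
      linarith)
    obtain ⟨h, hh, hhh0, hh3, hh4⟩ : ∃ h : ℝ, 0 < h ∧ 1 * h ≤ h0 ∧ 2 * k * a0 * h ≤ η / 3 ∧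
        Λ - θ ^ 2 < (φ (x1+h•e1)+φ (x1-h•e1)-2*φ x1)/h^2 := by
      have := ((ev_pos.and (ev_small 1 h0 hh0)).and
        ((ev_small (2 * k * a0) (η / 3) (by positivity)).and
          ((tendsto_secdiff hφ x1 e1).eventually (lt_mem_nhds hx1)))).exists
      obtain ⟨t, ⟨h1, h2⟩, h3, h4⟩ := this
      exact ⟨t, h1, h2, h3, h4⟩
    rw [lt_div_iff₀ (by positivity)] at hh4
    change _ < SD φ h x1 e1 at hh4
    obtain ⟨ε, hε, hε1, hε2, hε3⟩ : ∃ ε : ℝ, 0 < ε ∧ 1 * ε ≤ 1 / 2 ∧ (φ x1 - m) * ε ≤ θ ^ 2 ∧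
        (R ^ 2 + a0 + C) * ε ≤ η / 3 := by
      have := ((ev_pos.and
        (ev_small 1 (1 / 2) (by norm_num))).and
        ((ev_small (φ x1 - m) (θ ^ 2) (by positivity)).and
          (ev_small (R ^ 2 + a0 + C) (η / 3) (by positivity)))).exists
      obtain ⟨t, ⟨h1, h2⟩, h3, h4⟩ := this
      exact ⟨t, h1, h2, h3, h4⟩
    obtain ⟨x, e, κ, he, hκ, hκR, hgr, hin, hmax⟩ := key h ε hh (by linarith) hε (by linarith)
    have hh2 : 0 < h ^ 2 := by positivity
    have h1 := hmax x1 e1 he1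
    have h2 := SD_lower hφ hc h κ θ x e hgr
    have h3 := SD_le hφ Λ hΛ ((1 - θ) * h) x e he
    have h4 := SD_le hφ Λ hΛ h x e he
    have h5 : h ^ 2 * ((φ x1 - m) * ε) ≤ h ^ 2 * θ ^ 2 := mul_le_mul_of_nonneg_left hε2 hh2.le
    have h6 : ε * (φ x - m) ≤ 2 * θ ^ 2 := by
      apply le_of_mul_le_mul_left _ hh2; linarith
    have h7 : ε * h ^ 2 * m ≤ ε * h ^ 2 * φ x := mul_le_mul_of_nonneg_left (hm x) (by positivity)
    have h8 : θ * h ^ 2 * (2 * Λ - θ * Λ - 2 * θ) ≤ θ * h ^ 2 * (2 * κ) := by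
      have : SD φ h x e ≥ (Λ - 2 * θ ^ 2) * h ^ 2 := by linarith
      linarith
    have h9 := le_of_mul_le_mul_left h8 (by positivity)
    refine ⟨κ, by linarith, ?_⟩
    have h10 : ε * κ ^ 2 ≤ ε * R ^ 2 := by gcongr
    have h11 : C * (ε * (φ x - m)) ≤ C * (2 * θ) := mul_le_mul_of_nonneg_left (by linarith) hC
    have h12 : ε * (k * h * a0) ≤ 1 * (k * h * a0) := mul_le_mul_of_nonneg_right (by linarith) (by positivity)
    linarith
  have fin : Λ ^ 2 ≤ a0 + b0 * Λ := by
    by_contra hcon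
    push Not at hcon
    have hpos : b0 < Λ := by
      by_contra hle
      push Not at hle
      nlinarith [mul_le_mul_of_nonneg_right hle hΛ0]
    have hq : 0 < 1 + 2 * Λ - b0 := by linarith
    set F := Λ ^ 2 - (a0 + b0 * Λ) with hF
    have hF0 : 0 < F := by rw [hF]; linarith
    obtain ⟨κ, hκ1, hκ2⟩ := main (F / (2 * (1 + 2 * Λ - b0))) (by positivity)
    set η := F / (2 * (1 + 2 * Λ - b0)) with hη
    have hηF : η * (1 + 2 * Λ - b0) = F / 2 := by rw [hη]; field_simp
    have hh : -η * (2 * Λ - b0) ≤ (κ - Λ) * (2 * Λ - b0) :=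
      mul_le_mul_of_nonneg_right (by linarith) (by linarith)
    have : κ ^ 2 = Λ ^ 2 + (κ - Λ) * (2 * Λ - b0) + (κ - Λ) * b0 + (κ - Λ) ^ 2 := by ring
    have h2 := sq_nonneg (κ - Λ)
    linarith
  exact (hΛ x0 e0 he0).trans (hL Λ hΛ0 fin)

end Concl

section Final
variable {n : ℕ}

lemma QB_of {U : Euc n → ℝ} {p : ℝ} (hp : 0 < p) (hnp : (n : ℝ) ≤ p) (hreg : ContDiff ℝ 2 U)
    (hlow : ∀ x, -p < U x) (hintg : Integrable fun x : Euc n => (1 + U x / p) ^ (-p))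
    (hc : 0 < cLow U p univ) (hcC : cLow U p univ ≤ cUp U p univ)
    (hb : BddAbove (range (ratio0 U p))) : QB U p (cLow U p univ) (cUp U p univ) := by
  refine ⟨hreg.continuous, hnp, hp, hc, hc.trans_le hcC, ?_, ?_, hintg⟩
  · intro x
    have hx : 0 < p + ‖x‖ ^ 2 := by positivity
    rw [← le_div_iff₀ hx]
    refine csInf_le ⟨0, ?_⟩ ⟨x, mem_univ x, rfl⟩
    rintro _ ⟨y, -, rfl⟩
    have := hlow y
    exact div_nonneg (by linarith) (by positivity)
  · intro x
    have hx : 0 < p + ‖x‖ ^ 2 := by positivity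
    rw [← div_le_iff₀ hx]
    refine le_csSup ?_ ⟨x, mem_univ x, rfl⟩
    rw [image_univ]; exact hb

lemma cGrad_nonneg (U : Euc n → ℝ) (p : ℝ) : 0 ≤ cGrad U p univ := by
  apply Real.sSup_nonneg
  rintro _ ⟨y, -, rfl⟩
  unfold ratio1; positivity

lemma cGrad_bound {U : Euc n → ℝ} {p : ℝ} (hp : 0 < p) (hb : BddAbove (range (ratio1 U p))) (x : Euc n) :
    ‖gradient U x‖ ^ 2 ≤ 2 * cGrad U p univ * (p + ‖x‖ ^ 2) := by
  have hs : 0 < Real.sqrt p := Real.sqrt_pos.2 hp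
  have hx : 0 < (Real.sqrt p + ‖x‖) ^ 2 := by positivity
  have h1 : ratio1 U p x ≤ cGrad U p univ := by
    refine le_csSup ?_ ⟨x, mem_univ x, rfl⟩
    rw [image_univ]; exact hb
  unfold ratio1 at h1
  rw [div_le_iff₀ hx] at h1
  have h2 : (Real.sqrt p + ‖x‖) ^ 2 ≤ 2 * (p + ‖x‖ ^ 2) := by
    have := Real.sq_sqrt hp.le
    nlinarith [sq_nonneg (Real.sqrt p - ‖x‖)]
  have := mul_le_mul_of_nonneg_left h2 (cGrad_nonneg U p)
  linarith

lemma root1 (A B l : ℝ) (hA : 0 ≤ A) (hB : 0 ≤ B) (h : l ^ 2 ≤ A + 2 * Real.sqrt B * l) :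
    l ≤ Real.sqrt (A + B) + Real.sqrt B := by
  have hs := Real.sq_sqrt hB
  have : l - Real.sqrt B ≤ Real.sqrt (A + B) := by
    apply Real.le_sqrt_of_sq_le
    linarith [sub_sq l (Real.sqrt B)]
  linarith

lemma root2 (A B l : ℝ) (hA : 0 ≤ A) (hB : 0 ≤ B) (h : l ^ 2 ≤ A + 2 * B) :
    l ≤ Real.sqrt (A + B) + Real.sqrt B := by
  have hs := Real.sq_sqrt hB
  have hs2 := Real.sq_sqrt (by linarith : 0 ≤ A + B)
  apply le_of_sq_le_sq _ (by positivity)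
  nlinarith [Real.sqrt_nonneg B, Real.sqrt_nonneg (A + B), mul_nonneg (Real.sqrt_nonneg B) (Real.sqrt_nonneg (A + B))]
where
  le_of_sq_le_sq {a b : ℝ} (h : a ^ 2 ≤ b ^ 2) (hb : 0 ≤ b) : a ≤ b := abs_le_of_sq_le_sq' h hb |>.2

end Final

end Helpers

/-- **Sharper global finite-parameter Hessian estimate.** -/
theorem sharper_global_hessian_estimate
    {n : ℕ} (hn : 1 ≤ n) (d D : ℝ) (hnd : (n : ℝ) ≤ d) (hdD : d ≤ D)
    (V W : Euc n → ℝ) (hVreg : ContDiff ℝ 2 V) (hWreg : ContDiff ℝ 2 W)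
    (hVlow : ∀ x, -d < V x) (hWlow : ∀ y, -D < W y)
    (hZV : Integrable fun x : Euc n => (1 + V x / d) ^ (-d))
    (hZW : Integrable fun y : Euc n => (1 + W y / D) ^ (-D))
    (CV2 cW2 : ℝ) (hCV2 : 0 < CV2) (hcW2 : 0 < cW2)
    (hHessV : ∀ x v : Euc n, hess V x v ≤ CV2 * ‖v‖ ^ 2)
    (hHessW : ∀ y v : Euc n, cW2 * ‖v‖ ^ 2 ≤ hess W y v)
    (hc0V : 0 < cLow V d univ) (hc0C0V : cLow V d univ ≤ cUp V d univ)
    (hC0V : BddAbove (range (ratio0 V d)))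
    (hc0W : 0 < cLow W D univ) (hc0C0W : cLow W D univ ≤ cUp W D univ)
    (hC0W : BddAbove (range (ratio0 W D)))
    (hC1V : BddAbove (range (ratio1 V d))) (hC1W : BddAbove (range (ratio1 W D)))
    (φ : Euc n → ℝ) (hφreg : ContDiff ℝ 2 φ) (hφconv : ConvexOn ℝ univ φ)
    (hpush : Measure.map (fun x => gradient φ x) (muUP V d) = muUP W D)
    (K M Γ A B : ℝ)
    (hK : K = 3 * ((cUp V d univ / cLow V d univ) ^ d * (cUp W D univ / cLow W D univ) ^ D
        * (5 / 4) ^ d * 10 ^ (2 * d) * 3 ^ (-(n : ℝ)) * (D / d) ^ D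
        * (Ipol n d / Ipol n D)) ^ (1 / (2 * D - n)))
    (hM : M = d / D * K ^ 2)
    (hΓ : d < D → Γ = max 0 ((2 * d - D) / (D - d)))
    (hA : A = CV2 * cUp W D univ * (1 + M) / (cW2 * cLow V d univ))
    (hB : B = 4 * cGrad V d univ / (cW2 ^ 2 * cLow V d univ ^ 2) *
        (if d < D then
          min (cGrad W D univ * (D / d) * (1 + M)) (cW2 * cUp W D univ * (1 + M) * Γ)
        else cGrad W D univ * (D / d) * (1 + M))) :
    ∀ (x e : Euc n), ‖e‖ = 1 → hess φ x e ≤ Real.sqrt (A + B) + Real.sqrt B := by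
  have hn1 : (1 : ℝ) ≤ n := by exact_mod_cast hn
  have hd : 0 < d := by linarith
  have hD : 0 < D := by linarith
  have qV := QB_of hd hnd hVreg hVlow hZV hc0V hc0C0V hC0V
  have qW := QB_of hD (hnd.trans hdD) hWreg hWlow hZW hc0W hc0C0W hC0W
  have hS : Setup V W φ d D (cLow V d univ) (cUp V d univ) (cLow W D univ) (cUp W D univ) :=
    ⟨hn, qV, qW, hφreg, hφconv, hpush⟩
  have hgK := hS.grad_K hdD K hK
  have gV := cGrad_nonneg V d
  have gW := cGrad_nonneg W D
  have bV := cGrad_bound hd hC1V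
  have bW := cGrad_bound hD hC1W
  have hCW := qW.C0p
  clear hK
  generalize cLow V d univ = cV at *
  generalize cLow W D univ = cW at *
  generalize cUp V d univ = CV at *
  generalize cUp W D univ = CW at *
  generalize cGrad V d univ = C1V at *
  generalize cGrad W D univ = C1W at *
  have hsd : 0 < Real.sqrt d := Real.sqrt_pos.2 hd
  have hK0 : 0 ≤ K := by
    have h1 := (norm_nonneg _).trans (hgK 0)
    have h2 : 0 < max ‖(0 : Euc n)‖ (Real.sqrt d) := lt_max_of_lt_right hsd
    exact nonneg_of_mul_nonneg_left h1 h2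
  have hM0 : 0 ≤ M := by rw [hM]; positivity
  have hβeq : D / d * (1 + M) = D / d + K ^ 2 := by rw [hM]; field_simp
  have hS2 : Setup2 V W φ d D cV CV cW CW CV2 cW2 C1V C1W (D / d * (1 + M)) := by
    refine ⟨hS, hdD, hVreg, hWreg, hCV2, hcW2, hHessV, hHessW, gV, gW, bV, bW, by positivity, ?_⟩
    intro x
    rw [hβeq]
    have h1 := hgK x
    have h2 : ‖gradient φ x‖ ^ 2 ≤ K ^ 2 * (max ‖x‖ (Real.sqrt d)) ^ 2 := by
      rw [← mul_pow]; gcongr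
    have h3 : (max ‖x‖ (Real.sqrt d)) ^ 2 ≤ d + ‖x‖ ^ 2 := by
      rcases max_choice ‖x‖ (Real.sqrt d) with h | h <;> rw [h]
      · linarith
      · rw [Real.sq_sqrt hd.le]; nlinarith [sq_nonneg ‖x‖]
    have h4 := mul_le_mul_of_nonneg_left h3 (sq_nonneg K)
    have h5 : D / d * (d + ‖x‖ ^ 2) = D + D / d * ‖x‖ ^ 2 := by field_simp
    have h6 : 0 ≤ D / d * ‖x‖ ^ 2 := by positivity
    rw [add_mul, h5]; linarith
  obtain ⟨m, G, hG, hm, hsup, hGr⟩ := hS.growth K hK0 hgK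
  obtain ⟨at1, at2⟩ := hS2.atMax m G hG hm hGr
  have hex := Phi_max_exists hn hφreg hφconv K (Real.sqrt d) hK0 hsd.le hgK hsup
  have hA0 : 0 ≤ A := by rw [hA]; positivity
  have eA : CV2 * CW * (D / d * (1 + M)) / (D / d * cW2 * cV) = A := by
    rw [hA]; field_simp
  rw [eA] at at1 at2
  have case1 : B = 4 * C1V / (cW2 ^ 2 * cV ^ 2) * (C1W * (D / d) * (1 + M)) →
      ∀ (x e : Euc n), ‖e‖ = 1 → hess φ x e ≤ Real.sqrt (A + B) + Real.sqrt B := by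
    intro hB1 x e he
    have hB0 : 0 ≤ B := by rw [hB1]; positivity
    have eB : 4 * C1V * C1W * (D / d * (1 + M)) / (cW2 ^ 2 * cV ^ 2) = B := by rw [hB1]; ring
    rw [eB] at at1
    exact AtMax.concl hφreg hφconv hex hm hA0 (by positivity) at1 _
      (fun l _ h => root1 A B l hA0 hB0 h) x e he
  by_cases hlt : d < D
  · rw [if_pos hlt] at hB
    rcases min_choice (C1W * (D / d) * (1 + M)) (cW2 * CW * (1 + M) * Γ) with h | h <;> rw [h] at hB
    · exact case1 hB
    · intro x e he
      have hΓ' := hΓ hlt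
      have hΓ0 : 0 ≤ Γ := by rw [hΓ']; exact le_max_left _ _
      have hΓ1 : (2 * d - D) / (D - d) ≤ Γ := by rw [hΓ']; exact le_max_right _ _
      have hB0 : 0 ≤ B := by rw [hB]; positivity
      have hαΓ : 1 ≤ (D / d - 1) * (1 + Γ) := by
        have hDd : 0 < D - d := by linarith
        rw [div_le_iff₀ hDd] at hΓ1
        have : (D / d - 1) * (1 + Γ) = (D - d) * (1 + Γ) / d := by field_simp
        rw [this, le_div_iff₀ hd]
        linarith
      have at2' := at2 Γ hΓ0 hlt hαΓ
      have eB : 4 * C1V * CW * (D / d * (1 + M)) * Γ / (D / d * cW2 * cV ^ 2) = B := by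
        rw [hB]; field_simp
      rw [eB] at at2'
      exact AtMax.concl hφreg hφconv hex hm (by positivity) le_rfl at2' _
        (fun l _ h => root2 A B l hA0 hB0 (by linarith)) x e he
  · rw [if_neg hlt] at hB
    exact case1 hB
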